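/- arXiv:2507.18211 — 4 statements merged into one kernel-verified Lean document; each statement's English description precedes it below -/
import Mathlib

section
/- Let B₀ > 0 and −3 < γ ≤ 1, and define the collision frequency ν(v) = B₀ π ∫_{ℝ³} |v − w|^γ e^{−|w|²} dw for v ∈ ℝ³. Then there exist constants ν₀ > 0 and ν₁ > 0 such that ν₀ (1 + |v|)^γ ≤ ν(v) ≤ ν₁ (1 + |v|)^γ for all v ∈ ℝ³. -/
open MeasureTheory Real Set

noncomputable section

/-- `ℝ³` as a Euclidean space. -/
abbrev E3 : Type := EuclideanSpace ℝ (Fin 3)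

/-- The collision frequency `ν(v) = B₀ π ∫_{ℝ³} |v − w|^γ e^{−|w|²} dw`. -/
def nu (B₀ γ : ℝ) (v : E3) : ℝ :=
  B₀ * π * ∫ w : E3, ‖v - w‖ ^ γ * Real.exp (-‖w‖ ^ 2)

theorem rpow_le_rpow_mul_pow_of_le_mul {a b c γ : ℝ} {n : ℕ} (ha : 0 < a) (hb : 0 < b)
    (hc : 1 ≤ c) (hab : a ≤ b * c) (hba : b ≤ a * c) (hγ : |γ| ≤ n) :
    a ^ γ ≤ b ^ γ * c ^ n := by
  have hc0 : 0 < c := by linarith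
  obtain ⟨h1, h2⟩ := abs_le.1 hγ
  rw [← rpow_natCast c n]
  rcases le_total 0 γ with h | h
  · calc a ^ γ ≤ (b * c) ^ γ := by gcongr
      _ = b ^ γ * c ^ γ := mul_rpow hb.le hc0.le
      _ ≤ _ := by gcongr
  · calc a ^ γ ≤ (b / c) ^ γ :=
          rpow_le_rpow_of_nonpos (by positivity) ((div_le_iff₀ hc0).2 hba) h
      _ = b ^ γ * c ^ (-γ) := by
          rw [div_rpow hb.le hc0.le, rpow_neg hc0.le, div_eq_mul_inv]
      _ ≤ _ := by gcongr; linarith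

theorem one_add_norm_le_mul (x y : E3) : 1 + ‖x‖ ≤ (1 + ‖y‖) * (1 + ‖x - y‖) := by
  nlinarith [norm_le_norm_add_norm_sub' x y, mul_nonneg (norm_nonneg y) (norm_nonneg (x - y))]

/-- Peetre's inequality for real exponents of either sign. -/
theorem one_add_norm_rpow_le {γ : ℝ} {n : ℕ} (hγ : |γ| ≤ n) (x y : E3) :
    (1 + ‖x‖) ^ γ ≤ (1 + ‖y‖) ^ γ * (1 + ‖x - y‖) ^ n :=
  rpow_le_rpow_mul_pow_of_le_mul (by positivity) (by positivity) (by simp)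
    (one_add_norm_le_mul x y) (norm_sub_rev x y ▸ one_add_norm_le_mul y x) hγ

theorem pow_mul_exp_neg_sq_le {y : ℝ} (hy : 0 ≤ y) (n : ℕ) :
    (1 + y) ^ n * exp (-y ^ 2) ≤ n.factorial * exp 2 := by
  have h := pow_div_factorial_le_exp (1 + y) (by positivity) n
  rw [div_le_iff₀ (by positivity)] at h
  calc (1 + y) ^ n * exp (-y ^ 2) ≤ (exp (1 + y) * n.factorial) * exp (-y ^ 2) := by gcongr
    _ = n.factorial * exp (1 + y + -y ^ 2) := by rw [exp_add (1 + y)]; ring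
    _ ≤ _ := by gcongr; nlinarith [sq_nonneg (y - 1 / 2)]

theorem integrable_indicator_norm_rpow {γ : ℝ} (hγ : -3 < γ) :
    Integrable ((Metric.ball (0 : E3) 1).indicator fun u => ‖u‖ ^ γ) := by
  rw [integrable_indicator_iff measurableSet_ball,
    integrableOn_fun_norm_addHaar volume (f := fun y => y ^ γ)]
  have h : IntegrableOn (fun y : ℝ => y ^ (γ + 2)) (Ioo 0 1) :=
    (intervalIntegral.integrableOn_Ioo_rpow_iff one_pos).2 (by linarith)
  refine h.congr_fun (fun y hy => ?_) measurableSet_Ioo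
  simp [rpow_add hy.1, mul_comm]

theorem integrable_one_add_norm_pow_inv :
    Integrable fun w : E3 => ((1 + ‖w‖) ^ 4)⁻¹ := by
  refine (integrable_one_add_norm (E := E3) (μ := volume) (r := 4) (by simp; norm_num)).congr
    (.of_forall fun w => ?_)
  have : (0 : ℝ) ≤ 1 + ‖w‖ := by positivity
  simp only
  rw [rpow_neg this, ← rpow_natCast]; norm_num

theorem norm_sub_rpow_mul_exp_le {γ : ℝ} (hγ : |γ| ≤ 3) (v w : E3) :
    ‖v - w‖ ^ γ * exp (-‖w‖ ^ 2) ≤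
      (8 * (Nat.factorial 7 * exp 2) * (1 + ‖v‖) ^ γ) *
        (((1 + ‖w‖) ^ 4)⁻¹ + (Metric.ball (0 : E3) 1).indicator (fun u => ‖u‖ ^ γ) (v - w)) := by
  have hK := pow_mul_exp_neg_sq_le (norm_nonneg w) 7
  set K := (Nat.factorial 7 : ℝ) * exp 2
  have hK0 : 0 < K := by positivity
  set p := 1 + ‖w‖ with hp
  have hp1 : 1 ≤ p := by simp [hp]
  have hpe : (1 + ‖v - w‖) ^ γ ≤ (1 + ‖v‖) ^ γ * p ^ 3 := by
    simpa [hp] using one_add_norm_rpow_le (n := 3) (by simpa using hγ) (v - w) v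
  have hE : exp (-‖w‖ ^ 2) ≤ K * (p ^ 7)⁻¹ := by
    rw [← div_eq_mul_inv, le_div_iff₀ (by positivity)]; linarith
  have hγ' := abs_le.1 hγ
  have hp7 : p ^ 3 * (p ^ 7)⁻¹ = (p ^ 4)⁻¹ := by field_simp
  by_cases hu : ‖v - w‖ < 1
  · rw [indicator_of_mem (by simpa using hu)]
    have h1 : 1 ≤ 8 * ((1 + ‖v‖) ^ γ * p ^ 3) := by
      have h2 : 1 ≤ (1 + ‖v - w‖) ^ γ * (1 + ‖v - w‖) ^ 3 := by
        rw [← rpow_natCast, ← rpow_add (by positivity)]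
        exact one_le_rpow (by simp) (by push_cast; linarith)
      have h3 : (1 + ‖v - w‖) ^ 3 ≤ 8 := by
        calc (1 + ‖v - w‖) ^ 3 ≤ (1 + 1) ^ 3 := by gcongr
          _ = 8 := by norm_num
      calc (1 : ℝ) ≤ _ := h2
        _ ≤ ((1 + ‖v‖) ^ γ * p ^ 3) * 8 := by gcongr
        _ = _ := by ring
    calc ‖v - w‖ ^ γ * exp (-‖w‖ ^ 2)
        ≤ ‖v - w‖ ^ γ * (K * (p ^ 7)⁻¹) * (8 * ((1 + ‖v‖) ^ γ * p ^ 3)) :=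
          (mul_le_mul_of_nonneg_left hE (by positivity)).trans
            (le_mul_of_one_le_right (by positivity) h1)
      _ = (8 * K * (1 + ‖v‖) ^ γ) * (‖v - w‖ ^ γ * (p ^ 4)⁻¹) := by rw [← hp7]; ring
      _ ≤ _ := by
        gcongr
        have : (p ^ 4)⁻¹ ≤ 1 := inv_le_one_of_one_le₀ (one_le_pow₀ hp1)
        have h5 : 0 ≤ ‖v - w‖ ^ γ := by positivity
        have h6 : 0 ≤ (p ^ 4)⁻¹ := by positivity
        nlinarith
  · push Not at hu
    rw [indicator_of_notMem (by simpa using hu), add_zero]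
    have h1 := rpow_le_rpow_mul_pow_of_le_mul (n := 3) (a := ‖v - w‖) (b := 1 + ‖v - w‖) (c := 2)
      (by positivity) (by positivity) one_le_two (by linarith) (by linarith) (by simpa using hγ)
    calc ‖v - w‖ ^ γ * exp (-‖w‖ ^ 2)
        ≤ (((1 + ‖v‖) ^ γ * p ^ 3) * 2 ^ 3) * (K * (p ^ 7)⁻¹) := by
          refine mul_le_mul (h1.trans ?_) hE (by positivity) (by positivity)
          gcongr
      _ = _ := by rw [← hp7]; ring

theorem integrable_norm_sub_rpow_mul_exp {γ : ℝ} (hγl : -3 < γ) (hγu : γ ≤ 3) (v : E3) :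
    Integrable fun w : E3 => ‖v - w‖ ^ γ * exp (-‖w‖ ^ 2) := by
  refine ((integrable_one_add_norm_pow_inv.add
    ((integrable_indicator_norm_rpow hγl).comp_sub_left v)).const_mul
      (8 * (Nat.factorial 7 * exp 2) * (1 + ‖v‖) ^ γ)).mono' ?_ (.of_forall fun w => ?_)
  · exact Measurable.aestronglyMeasurable (by fun_prop)
  · rw [norm_of_nonneg (by positivity)]
    exact norm_sub_rpow_mul_exp_le (abs_le.2 ⟨hγl.le, hγu⟩) v w

/-- A minorant, up to the factor `(1 + ‖v‖) ^ γ`, of the symmetrized integrand. -/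
def lowerProfile (w : E3) : ℝ :=
  min ‖w‖ 1 ^ 3 / (8 * (1 + ‖w‖) ^ 3) * exp (-‖w‖ ^ 2)

theorem lowerProfile_nonneg (w : E3) : 0 ≤ lowerProfile w := by
  unfold lowerProfile; positivity

theorem continuous_lowerProfile : Continuous lowerProfile := by
  unfold lowerProfile
  fun_prop (disch := intros; positivity)

theorem integrable_lowerProfile : Integrable lowerProfile := by
  refine (integrable_one_add_norm_pow_inv.const_mul (Nat.factorial 4 * exp 2)).mono'
    continuous_lowerProfile.aestronglyMeasurable (.of_forall fun w => ?_)
  rw [norm_of_nonneg (lowerProfile_nonneg w), ← div_eq_mul_inv, le_div_iff₀ (by positivity)]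
  refine le_trans ?_ (pow_mul_exp_neg_sq_le (norm_nonneg w) 4)
  rw [mul_comm]
  gcongr
  refine mul_le_of_le_one_left (exp_nonneg _) (div_le_one_of_le₀ ?_ (by positivity))
  have h1 : min ‖w‖ 1 ^ 3 ≤ 1 := pow_le_one₀ (by positivity) (min_le_right _ _)
  have h2 : 1 ≤ (1 + ‖w‖) ^ 3 := one_le_pow₀ (by simp)
  linarith

theorem integral_lowerProfile_pos : 0 < ∫ w, lowerProfile w := by
  obtain ⟨w, hw⟩ := exists_ne (0 : E3)
  refine integral_pos_of_integrable_nonneg_nonzero (x := w) continuous_lowerProfile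
    integrable_lowerProfile lowerProfile_nonneg ?_
  have : 0 < ‖w‖ := norm_pos_iff.2 hw
  unfold lowerProfile
  positivity

theorem mul_lowerProfile_le {γ : ℝ} (hγ : |γ| ≤ 3) {v w : E3} (hvw : v ≠ w) :
    (1 + ‖v‖) ^ γ * lowerProfile w ≤
      ‖v - w‖ ^ γ * exp (-‖w‖ ^ 2) + ‖v - -w‖ ^ γ * exp (-‖-w‖ ^ 2) := by
  rw [norm_neg, ← add_mul, lowerProfile, ← mul_assoc]
  gcongr
  set m := min ‖w‖ 1 with hm
  have hm0 : 0 ≤ m := by positivity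
  have hm1 : m ≤ 1 := min_le_right _ _
  have hmw : m ≤ ‖w‖ := min_le_left _ _
  have hγ' := abs_le.1 hγ
  have hp : 1 ≤ (1 + ‖w‖) ^ 3 := one_le_pow₀ (by simp)
  rcases le_or_gt 0 γ with h | h
  · have hsum : (1 + ‖v‖) * (m / 2) ≤ max ‖v - w‖ ‖v - -w‖ := by
      have h1 : 2 * ‖v‖ ≤ ‖v - w‖ + ‖v - -w‖ := by
        have := norm_add_le (v - w) (v - -w)
        rwa [show v - w + (v - -w) = (2 : ℝ) • v by rw [two_smul]; abel, norm_smul,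
          norm_of_nonneg zero_le_two] at this
      have h2 : 2 * ‖w‖ ≤ ‖v - w‖ + ‖v - -w‖ := by
        have := norm_sub_le (v - -w) (v - w)
        rw [show v - -w - (v - w) = (2 : ℝ) • w by rw [two_smul]; abel, norm_smul,
          norm_of_nonneg zero_le_two] at this
        linarith
      have h3 := le_max_left ‖v - w‖ ‖v - -w‖
      have h4 := le_max_right ‖v - w‖ ‖v - -w‖
      nlinarith [mul_nonneg (norm_nonneg v) (sub_nonneg.2 hm1)]
    have hmax : max ‖v - w‖ ‖v - -w‖ ^ γ ≤ ‖v - w‖ ^ γ + ‖v - -w‖ ^ γ := by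
      have h1 : 0 ≤ ‖v - w‖ ^ γ := by positivity
      have h2 : 0 ≤ ‖v - -w‖ ^ γ := by positivity
      rcases max_choice ‖v - w‖ ‖v - -w‖ with e | e <;> rw [e] <;> linarith
    have hpow : (m / 2) ^ 3 ≤ (m / 2) ^ γ := by
      rcases hm0.eq_or_lt with e | e
      · rw [← e]; simp only [zero_div]; rw [zero_pow three_ne_zero]; positivity
      · rw [← rpow_natCast]
        exact rpow_le_rpow_of_exponent_ge (by positivity) (by linarith) (by push_cast; linarith)
    calc (1 + ‖v‖) ^ γ * (m ^ 3 / (8 * (1 + ‖w‖) ^ 3))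
        ≤ (1 + ‖v‖) ^ γ * (m / 2) ^ 3 := by
          gcongr
          rw [div_pow]
          exact div_le_div_of_nonneg_left (by positivity) (by positivity) (by linarith)
      _ ≤ (1 + ‖v‖) ^ γ * (m / 2) ^ γ := by gcongr
      _ = ((1 + ‖v‖) * (m / 2)) ^ γ := (mul_rpow (by positivity) (by positivity)).symm
      _ ≤ _ := (rpow_le_rpow (by positivity) hsum h).trans hmax
  · have hu : 0 < ‖v - w‖ := norm_pos_iff.2 (sub_ne_zero.2 hvw)
    have hpe : (1 + ‖v‖) ^ γ ≤ (1 + ‖v - w‖) ^ γ * (1 + ‖w‖) ^ 3 := by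
      simpa using one_add_norm_rpow_le (n := 3) (by simpa using hγ) v (v - w)
    have h1 : m ^ 3 / (8 * (1 + ‖w‖) ^ 3) ≤ ((1 + ‖w‖) ^ 3)⁻¹ := by
      rw [← one_div]
      exact div_le_div₀ zero_le_one (pow_le_one₀ hm0 hm1) (by positivity) (by linarith)
    calc (1 + ‖v‖) ^ γ * (m ^ 3 / (8 * (1 + ‖w‖) ^ 3))
        ≤ ((1 + ‖v - w‖) ^ γ * (1 + ‖w‖) ^ 3) * ((1 + ‖w‖) ^ 3)⁻¹ := by gcongr
      _ = (1 + ‖v - w‖) ^ γ := mul_inv_cancel_right₀ (by positivity) _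
      _ ≤ ‖v - w‖ ^ γ := rpow_le_rpow_of_nonpos hu (by linarith) h.le
      _ ≤ _ := le_add_of_nonneg_right (by positivity)

/-- There exist `ν₀, ν₁ > 0` with `ν₀ (1+|v|)^γ ≤ ν(v) ≤ ν₁ (1+|v|)^γ` for all `v`. -/
theorem collision_frequency_bounds (B₀ γ : ℝ) (hB₀ : 0 < B₀) (hγl : -3 < γ) (hγu : γ ≤ 1) :
    ∃ ν₀ > (0 : ℝ), ∃ ν₁ > (0 : ℝ), ∀ v : E3,
      ν₀ * (1 + ‖v‖) ^ γ ≤ nu B₀ γ v ∧ nu B₀ γ v ≤ ν₁ * (1 + ‖v‖) ^ γ := by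
  have hγ : |γ| ≤ 3 := abs_le.2 ⟨hγl.le, by linarith⟩
  have hint := integrable_norm_sub_rpow_mul_exp hγl (by linarith)
  set L := ∫ w, lowerProfile w
  have hL : 0 < L := integral_lowerProfile_pos
  set K := 8 * ((Nat.factorial 7 : ℝ) * exp 2)
  set C := (∫ w : E3, ((1 + ‖w‖) ^ 4)⁻¹) +
    ∫ u, (Metric.ball (0 : E3) 1).indicator (fun u => ‖u‖ ^ γ) u
  have hlow (v : E3) : (1 + ‖v‖) ^ γ * L ≤ 2 * ∫ w : E3, ‖v - w‖ ^ γ * exp (-‖w‖ ^ 2) := by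
    have hsymm := integral_neg_eq_self (fun w : E3 => ‖v - w‖ ^ γ * exp (-‖w‖ ^ 2)) volume
    rw [← integral_const_mul, two_mul]
    nth_rewrite 2 [← hsymm]
    rw [← integral_add (hint v) (hint v).comp_neg]
    refine integral_mono_ae (integrable_lowerProfile.const_mul _)
      ((hint v).add (hint v).comp_neg) ?_
    filter_upwards [Measure.ae_ne volume v] with w hw
    exact mul_lowerProfile_le hγ hw.symm
  have hup (v : E3) :
      ∫ w : E3, ‖v - w‖ ^ γ * exp (-‖w‖ ^ 2) ≤ K * (1 + ‖v‖) ^ γ * C := by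
    have hi := (integrable_indicator_norm_rpow hγl).comp_sub_left v
    calc _ ≤ ∫ w : E3, K * (1 + ‖v‖) ^ γ * (((1 + ‖w‖) ^ 4)⁻¹ +
          (Metric.ball (0 : E3) 1).indicator (fun u => ‖u‖ ^ γ) (v - w)) :=
          integral_mono (hint v) ((integrable_one_add_norm_pow_inv.add hi).const_mul _)
            (norm_sub_rpow_mul_exp_le hγ v)
      _ = K * (1 + ‖v‖) ^ γ * C := by
        rw [integral_const_mul, integral_add integrable_one_add_norm_pow_inv hi,
          integral_sub_left_eq_self]
  have hC : 0 < C := by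
    have h := (hlow 0).trans (mul_le_mul_of_nonneg_left (hup 0) zero_le_two)
    simp only [norm_zero, add_zero, one_rpow, one_mul, mul_one] at h
    have hK : 0 < K := by positivity
    by_contra! hC
    nlinarith [mul_nonpos_of_nonneg_of_nonpos hK.le hC]
  refine ⟨B₀ * π * (L / 2), by positivity, B₀ * π * (K * C), by positivity, fun v => ⟨?_, ?_⟩⟩
  · rw [nu, mul_assoc]
    gcongr
    linarith [hlow v]
  · rw [nu, mul_assoc (B₀ * π)]
    gcongr
    linarith [hup v]
end
end

section
/- Let −3 < γ ≤ 1 and let k* : ℝ³ × ℝ³ → ℝ be a measurable kernel for which there exist constants C₀ > 0 and α₁ > 0 such that |k*(v, v_*)| ≤ C₀ w_γ(|v − v_*|) (1 + |v| + |v_*|)^{γ−1} (1 + |v|)^{−γ} e^{−α₁ |v − v_*|²} for all v ≠ v_*. Then there exists a constant C > 0, depending only on γ, C₀ and α₁, such that ∫_{ℝ³} |k*(v, v_*)| dv_* ≤ C (1 + |v|)^{−1} for all v ∈ ℝ³, and ∫_{ℝ³} |k*(v, v_*)| (1 + |v|)^γ dv ≤ C (1 + |v_*|)^{γ−1} for all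 v_* ∈ ℝ³. -/
open MeasureTheory Real Set
open scoped ENNReal

noncomputable section

/-- The singular weight `w_γ`. -/
def wGamma (γ r : ℝ) : ℝ :=
  if -1 < γ then 1 / r
  else if γ = -1 then (|Real.log r| + 1) / r
  else 1 / r ^ |γ|

theorem wGamma_nonneg (γ : ℝ) {r : ℝ} (hr : 0 ≤ r) : 0 ≤ wGamma γ r := by
  unfold wGamma
  split_ifs <;> positivity

theorem measurable_wGamma (γ : ℝ) : Measurable (wGamma γ) := by
  unfold wGamma
  split_ifs <;> fun_prop

theorem abs_log_le_add_inv {r : ℝ} (hr : 0 < r) : |Real.log r| ≤ r + r⁻¹ := by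
  have h₁ := Real.log_le_sub_one_of_pos hr
  have h₂ := Real.log_le_sub_one_of_pos (inv_pos.2 hr)
  rw [Real.log_inv] at h₂
  have h₃ := inv_pos.2 hr
  exact abs_le.2 ⟨by linarith, by linarith⟩

/-- The radial density of `w_γ(|u|) e^{-α|u|²}` on `ℝ³` is integrable. -/
theorem integrableOn_sq_mul_wGamma_mul_exp {γ α : ℝ} (hγ : -3 < γ) (hα : 0 < α) :
    IntegrableOn (fun y : ℝ => y ^ 2 * (wGamma γ y * Real.exp (-α * y ^ 2))) (Ioi 0) := by
  have key {s : ℝ} (hs : -1 < s) := integrableOn_rpow_mul_exp_neg_mul_sq hα hs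
  by_cases h₁ : -1 < γ
  · refine (key (s := 1) (by norm_num)).congr_fun (fun y hy => ?_) measurableSet_Ioi
    have hy : 0 < y := hy
    simp only [wGamma, if_pos h₁, Real.rpow_one]
    field_simp
  by_cases h₂ : γ = -1
  · have hdom := ((key (s := 2) (by norm_num)).add (key (s := 1) (by norm_num))).add
      (key (s := 0) (by norm_num))
    have hmeas := measurable_wGamma γ
    refine Integrable.mono' hdom (by fun_prop) ?_
    filter_upwards [ae_restrict_mem measurableSet_Ioi] with y hy
    have hy : 0 < y := hy
    have hw := wGamma_nonneg γ hy.le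
    rw [Real.norm_of_nonneg (by positivity)]
    simp only [wGamma, if_neg h₁, if_pos h₂, Pi.add_apply, Real.rpow_one, Real.rpow_zero,
      Real.rpow_two]
    calc y ^ 2 * ((|Real.log y| + 1) / y * Real.exp (-α * y ^ 2))
        = y * (|Real.log y| + 1) * Real.exp (-α * y ^ 2) := by field_simp
      _ ≤ y * (y + y⁻¹ + 1) * Real.exp (-α * y ^ 2) := by
          gcongr
          exact abs_log_le_add_inv hy
      _ = _ := by field_simp; ring
  · have hneg : γ < 0 := by linarith [not_lt.1 h₁]
    refine (key (s := 2 + γ) (by linarith)).congr_fun (fun y hy => ?_) measurableSet_Ioi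
    have hy : 0 < y := hy
    simp only [wGamma, if_neg h₁, if_neg h₂, abs_of_neg hneg, Real.rpow_add hy, Real.rpow_two,
      Real.rpow_neg hy.le, one_div, inv_inv, mul_assoc]

theorem integrable_wGamma_norm_mul_exp {γ α : ℝ} (hγ : -3 < γ) (hα : 0 < α) :
    Integrable (fun u : E3 => wGamma γ ‖u‖ * Real.exp (-α * ‖u‖ ^ 2)) := by
  refine (integrable_fun_norm_addHaar volume
    (f := fun r : ℝ => wGamma γ r * Real.exp (-α * r ^ 2))).2 ?_
  simpa using integrableOn_sq_mul_wGamma_mul_exp hγ hα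

/-- An integral of a function dominated almost everywhere by a multiple of `G ∘ T`, where `T`
preserves the integral of `G`. -/
theorem lintegral_ofReal_le_of_le_mul {X : Type*} [MeasurableSpace X] {μ : Measure X}
    {F G : X → ℝ} {T : X → X} {c : ℝ} (hG : Integrable G μ) (hG₀ : 0 ≤ G) (hc : 0 ≤ c)
    (hT : ∫⁻ x, ENNReal.ofReal (G (T x)) ∂μ = ∫⁻ x, ENNReal.ofReal (G x) ∂μ)
    (hF : ∀ᵐ x ∂μ, F x ≤ c * G (T x)) :
    ∫⁻ x, ENNReal.ofReal (F x) ∂μ ≤ ENNReal.ofReal (c * ∫ x, G x ∂μ) :=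
  calc ∫⁻ x, ENNReal.ofReal (F x) ∂μ
      ≤ ∫⁻ x, ENNReal.ofReal c * ENNReal.ofReal (G (T x)) ∂μ := by
        refine lintegral_mono_ae (hF.mono fun x hx => ?_)
        rw [← ENNReal.ofReal_mul hc]
        exact ENNReal.ofReal_le_ofReal hx
    _ = ENNReal.ofReal (c * ∫ x, G x ∂μ) := by
        rw [lintegral_const_mul' _ _ ENNReal.ofReal_ne_top, hT, ENNReal.ofReal_mul hc,
          ofReal_integral_eq_lintegral_ofReal hG (ae_of_all _ hG₀)]

/-- Decay estimates for a kernel `k*` satisfying the pointwise bound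
`|k*(v,v_*)| ≤ C₀ w_γ(|v−v_*|)(1+|v|+|v_*|)^{γ−1}(1+|v|)^{−γ} e^{−α₁|v−v_*|²}`:
`∫ |k*(v,·)| ≤ C (1+|v|)⁻¹` and `∫ |k*(·,v_*)| (1+|·|)^γ ≤ C (1+|v_*|)^{γ−1}`. -/
theorem kstar_decay_bounds (γ C₀ α₁ : ℝ) (hγl : -3 < γ) (hγu : γ ≤ 1)
    (hC₀ : 0 < C₀) (hα₁ : 0 < α₁) :
    ∃ C > (0 : ℝ), ∀ kstar : E3 → E3 → ℝ, Measurable (Function.uncurry kstar) →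
      (∀ v vs : E3, v ≠ vs →
        |kstar v vs| ≤ C₀ * wGamma γ ‖v - vs‖ * (1 + ‖v‖ + ‖vs‖) ^ (γ - 1) *
          (1 + ‖v‖) ^ (-γ) * Real.exp (-α₁ * ‖v - vs‖ ^ 2)) →
      (∀ v : E3,
        ∫⁻ vs : E3, ENNReal.ofReal |kstar v vs| ≤ ENNReal.ofReal (C * (1 + ‖v‖)⁻¹)) ∧
      (∀ vs : E3,
        ∫⁻ v : E3, ENNReal.ofReal (|kstar v vs| * (1 + ‖v‖) ^ γ) ≤
          ENNReal.ofReal (C * (1 + ‖vs‖) ^ (γ - 1))) := by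
  set G : E3 → ℝ := fun u => wGamma γ ‖u‖ * Real.exp (-α₁ * ‖u‖ ^ 2) with hG
  have hint : Integrable G := integrable_wGamma_norm_mul_exp hγl hα₁
  have hG₀ : 0 ≤ G := fun u => mul_nonneg (wGamma_nonneg γ (norm_nonneg u)) (Real.exp_pos _).le
  have hI : 0 ≤ ∫ u, G u := integral_nonneg hG₀
  have hne (a : E3) : ∀ᵐ x : E3, x ≠ a := by simp [ae_iff]
  refine ⟨C₀ * (∫ u, G u) + 1, by positivity, fun kstar _ hk => ⟨fun v => ?_, fun vs => ?_⟩⟩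
  · refine (lintegral_ofReal_le_of_le_mul (c := C₀ * (1 + ‖v‖)⁻¹) (T := fun vs => v - vs)
      hint hG₀ (by positivity)
      (lintegral_sub_left_eq_self (fun u => ENNReal.ofReal (G u)) v) ?_).trans
      (ENNReal.ofReal_le_ofReal ?_)
    · filter_upwards [hne v] with vs hvs
      have hv : 0 < 1 + ‖v‖ := by positivity
      have hw := wGamma_nonneg γ (norm_nonneg (v - vs))
      calc |kstar v vs| ≤ _ := hk v vs hvs.symm
        _ ≤ C₀ * wGamma γ ‖v - vs‖ * (1 + ‖v‖) ^ (γ - 1) * (1 + ‖v‖) ^ (-γ) *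
            Real.exp (-α₁ * ‖v - vs‖ ^ 2) := by
          gcongr ?_ * _ * _
          refine mul_le_mul_of_nonneg_left
            (Real.rpow_le_rpow_of_nonpos hv ?_ (by linarith)) (by positivity)
          linarith [norm_nonneg vs]
        _ = C₀ * ((1 + ‖v‖) ^ (γ - 1) * (1 + ‖v‖) ^ (-γ)) * G (v - vs) := by
          simp only [hG]; ring
        _ = C₀ * (1 + ‖v‖)⁻¹ * G (v - vs) := by
          rw [← Real.rpow_add hv, ← Real.rpow_neg_one]
          congr 3
          ring
    · rw [mul_right_comm]
      gcongr
      linarith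
  · refine (lintegral_ofReal_le_of_le_mul (c := C₀ * (1 + ‖vs‖) ^ (γ - 1)) (T := fun v => v - vs)
      hint hG₀ (by positivity)
      (lintegral_sub_right_eq_self (fun u => ENNReal.ofReal (G u)) vs) ?_).trans
      (ENNReal.ofReal_le_ofReal ?_)
    · filter_upwards [hne vs] with v hvs
      have hv : 0 < 1 + ‖v‖ := by positivity
      have hw := wGamma_nonneg γ (norm_nonneg (v - vs))
      calc
        |kstar v vs| * (1 + ‖v‖) ^ γ ≤
            (C₀ * wGamma γ ‖v - vs‖ * (1 + ‖v‖ + ‖vs‖) ^ (γ - 1) * (1 + ‖v‖) ^ (-γ) *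
            Real.exp (-α₁ * ‖v - vs‖ ^ 2)) * (1 + ‖v‖) ^ γ := by
          gcongr
          exact hk v vs hvs
        _ = C₀ * G (v - vs) * (1 + ‖v‖ + ‖vs‖) ^ (γ - 1) := by
          rw [Real.rpow_neg hv.le]
          simp only [hG]
          field_simp
        _ ≤ C₀ * G (v - vs) * (1 + ‖vs‖) ^ (γ - 1) := by
          refine mul_le_mul_of_nonneg_left
            (Real.rpow_le_rpow_of_nonpos (by positivity) ?_ (by linarith))
            (mul_nonneg hC₀.le (hG₀ _))
          linarith [norm_nonneg v]
        _ = C₀ * (1 + ‖vs‖) ^ (γ - 1) * G (v - vs) := by ring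
    · rw [mul_right_comm]
      gcongr
      linarith
end
end

section
/- Let −3 < γ ≤ −2 and let k* : ℝ³ × ℝ³ → ℝ be a measurable kernel for which there exist constants C₀ > 0 and α₁, α₂, α₃ > 0 such that |k*(v, v_*)| ≤ C₀ w_γ(|v − v_*|) (1 + |v| + |v_*|)^{γ−1} (1 + |v|)^{−γ} e^{−α₁ |v − v_*|²} e^{−α₃ ((v − v_*)·v_*/|v − v_*| + α₂ |v − v_*|)²} for all v ≠ v_*. Then there exists a constant C > 0, depending only on γ, C₀, α₁, α₂ and α₃, such that ∫_{ℝ³} |k*(v, v_*)| (1 + |v|)^{−1} dv ≤ C (1 + |v_*|)^γ for all v_* ∈ ℝ³. -/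
open MeasureTheory Real Set
open scoped ENNReal RealInnerProductSpace

noncomputable section

/-- A radial function on the plane, integrated in polar coordinates. -/
theorem lintegral_radial_plane (G : ℝ → ℝ≥0∞) (hG : Measurable G) :
    ∫⁻ q : ℝ × ℝ, G (q.1 ^ 2 + q.2 ^ 2) =
      ENNReal.ofReal (2 * π) * ∫⁻ ρ in Ioi (0 : ℝ), ENNReal.ofReal ρ * G (ρ ^ 2) := by
  have hsq (p : ℝ × ℝ) : (p.1 * cos p.2) ^ 2 + (p.1 * sin p.2) ^ 2 = p.1 ^ 2 := by
    rw [mul_pow, mul_pow, ← mul_add, cos_sq_add_sin_sq, mul_one]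
  rw [← lintegral_comp_polarCoord_symm]
  simp only [polarCoord_symm_apply, polarCoord_target, smul_eq_mul, hsq]
  rw [Measure.volume_eq_prod, ← Measure.prod_restrict, lintegral_prod _ (by fun_prop)]
  simp only [lintegral_const, Measure.restrict_apply_univ, Real.volume_Ioo]
  rw [lintegral_mul_const _ (by fun_prop), mul_comm]
  ring_nf

/-- The substitution `r = √(s² + ρ²)`, with the range of integration enlarged to `r > 0`. -/
theorem lintegral_sqrt_sq_add_sq_le (f : ℝ → ℝ≥0∞) (s : ℝ) :
    ∫⁻ ρ in Ioi (0 : ℝ), ENNReal.ofReal ρ * f (√(s ^ 2 + ρ ^ 2)) ≤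
      ∫⁻ r in Ioi (0 : ℝ), ENNReal.ofReal r * f r := by
  have hpos : ∀ ρ ∈ Ioi (0 : ℝ), 0 < s ^ 2 + ρ ^ 2 := fun ρ hρ => by
    have : 0 < ρ := hρ
    positivity
  have hderiv : ∀ ρ ∈ Ioi (0 : ℝ),
      HasDerivWithinAt (fun ρ => √(s ^ 2 + ρ ^ 2)) (ρ / √(s ^ 2 + ρ ^ 2)) (Ioi 0) ρ := by
    intro ρ hρ
    have h := ((((hasDerivAt_id ρ).pow 2).const_add (s ^ 2)).sqrt (hpos ρ hρ).ne').hasDerivWithinAt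
      (s := Ioi 0)
    refine h.congr_deriv ?_
    simp only [id, Nat.cast_ofNat, Nat.add_one_sub_one, pow_one, mul_one]
    exact mul_div_mul_left _ _ two_ne_zero
  have hinj : InjOn (fun ρ => √(s ^ 2 + ρ ^ 2)) (Ioi (0 : ℝ)) := by
    intro a ha b hb hab
    have h := (Real.sqrt_inj (hpos a ha).le (hpos b hb).le).1 hab
    exact (pow_left_inj₀ (le_of_lt ha) (le_of_lt hb) two_ne_zero).1 (add_left_cancel h)
  have himage : (fun ρ => √(s ^ 2 + ρ ^ 2)) '' Ioi (0 : ℝ) ⊆ Ioi 0 := by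
    rintro _ ⟨ρ, hρ, rfl⟩
    exact Real.sqrt_pos.2 (hpos ρ hρ)
  calc
    _ = ∫⁻ ρ in Ioi (0 : ℝ), ENNReal.ofReal |ρ / √(s ^ 2 + ρ ^ 2)| *
          (ENNReal.ofReal (√(s ^ 2 + ρ ^ 2)) * f (√(s ^ 2 + ρ ^ 2))) := by
      refine setLIntegral_congr_fun measurableSet_Ioi fun ρ hρ => ?_
      have hr := Real.sqrt_pos.2 (hpos ρ hρ)
      have h0 : 0 < ρ := hρ
      rw [← mul_assoc, ← ENNReal.ofReal_mul (abs_nonneg _), abs_of_pos (by positivity),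
        div_mul_cancel₀ _ hr.ne']
    _ = ∫⁻ r in (fun ρ => √(s ^ 2 + ρ ^ 2)) '' Ioi (0 : ℝ), ENNReal.ofReal r * f r :=
      (lintegral_image_eq_lintegral_abs_deriv_mul measurableSet_Ioi hderiv hinj
        fun r => ENNReal.ofReal r * f r).symm
    _ ≤ _ := lintegral_mono_set himage

/-- Integration in Cartesian coordinates whose first axis is the unit vector `e`. -/
theorem lintegral_inner_norm_eq (F : ℝ → ℝ → ℝ≥0∞) (hF : Measurable (Function.uncurry F))
    (e : E3) (he : ‖e‖ = 1) :
    ∫⁻ u : E3, F ⟪u, e⟫ ‖u‖ =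
      ∫⁻ s : ℝ, ∫⁻ q : ℝ × ℝ, F s (√(s ^ 2 + (q.1 ^ 2 + q.2 ^ 2))) := by
  obtain ⟨b, hb⟩ := Orthonormal.exists_orthonormalBasis_extension_of_card_eq (𝕜 := ℝ)
    (E := E3) (ι := Fin 3) (by simp) (v := fun _ => e) (s := {0}) (by
      constructor
      · intro i
        simpa using he
      · intro i j hij
        exact (hij (Subsingleton.elim i j)).elim)
  have hb0 : b 0 = e := hb 0 rfl
  have hmeas : Measurable fun p : ℝ × ℝ × ℝ => F p.1 (√(p.1 ^ 2 + (p.2.1 ^ 2 + p.2.2 ^ 2))) :=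
    hF.comp (g := Function.uncurry F)
      (f := fun p : ℝ × ℝ × ℝ => (p.1, √(p.1 ^ 2 + (p.2.1 ^ 2 + p.2.2 ^ 2)))) (by fun_prop)
  have hmp := (((MeasurePreserving.id (volume : Measure ℝ)).prod
      (volume_preserving_finTwoArrow ℝ)).comp
        (volume_preserving_piFinSuccAbove (fun _ : Fin 3 => ℝ) 0)).comp
          ((PiLp.volume_preserving_ofLp (Fin 3)).comp b.measurePreserving_repr)
  rw [← lintegral_prod (fun p : ℝ × ℝ × ℝ => F p.1 (√(p.1 ^ 2 + (p.2.1 ^ 2 + p.2.2 ^ 2))))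
    hmeas.aemeasurable, ← hmp.lintegral_comp hmeas]
  refine lintegral_congr fun u => ?_
  have h0 : ⟪u, e⟫ = b.repr u 0 := by
    rw [b.repr_apply_apply, hb0, real_inner_comm]
  have hn : ‖u‖ = √((b.repr u 0) ^ 2 + ((b.repr u 1) ^ 2 + (b.repr u 2) ^ 2)) := by
    rw [← b.repr.norm_map u, EuclideanSpace.norm_eq, Fin.sum_univ_three]
    simp only [Real.norm_eq_abs, sq_abs, add_assoc]
  rw [h0, hn]
  rfl

/-- A function of `⟪u, e⟫` and `‖u‖`, integrated in bipolar fashion. The right-hand side drops the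
constraint `|s| ≤ r`, which `F` has to encode itself if needed. -/
theorem lintegral_inner_norm_le (F : ℝ → ℝ → ℝ≥0∞) (hF : Measurable (Function.uncurry F))
    (e : E3) (he : ‖e‖ = 1) :
    ∫⁻ u : E3, F ⟪u, e⟫ ‖u‖ ≤
      ENNReal.ofReal (2 * π) * ∫⁻ r in Ioi (0 : ℝ), ENNReal.ofReal r * ∫⁻ s : ℝ, F s r := by
  have hmeas : Measurable fun p : ℝ × ℝ => ENNReal.ofReal p.2 * F p.1 p.2 :=
    (by fun_prop : Measurable fun p : ℝ × ℝ => ENNReal.ofReal p.2).mul hF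
  calc
    _ = ∫⁻ s : ℝ, ENNReal.ofReal (2 * π) *
          ∫⁻ ρ in Ioi (0 : ℝ), ENNReal.ofReal ρ * F s (√(s ^ 2 + ρ ^ 2)) := by
      rw [lintegral_inner_norm_eq F hF e he]
      refine lintegral_congr fun s => ?_
      exact lintegral_radial_plane (fun t => F s (√(s ^ 2 + t)))
        (hF.comp (g := Function.uncurry F) (f := fun t => (s, √(s ^ 2 + t))) (by fun_prop))
    _ ≤ ∫⁻ s : ℝ, ENNReal.ofReal (2 * π) *
          ∫⁻ r in Ioi (0 : ℝ), ENNReal.ofReal r * F s r := by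
      gcongr ∫⁻ s, _ * ?_
      exact lintegral_sqrt_sq_add_sq_le (F s) s
    _ = ENNReal.ofReal (2 * π) * ∫⁻ r in Ioi (0 : ℝ), ∫⁻ s : ℝ, ENNReal.ofReal r * F s r := by
      rw [lintegral_const_mul' _ _ ENNReal.ofReal_ne_top,
        lintegral_lintegral_swap hmeas.aemeasurable]
    _ = _ := by
      congr 1
      refine lintegral_congr fun r => ?_
      exact lintegral_const_mul' _ _ ENNReal.ofReal_ne_top

/-- The Gaussian concentrated on a slab of width `r / X` in `[-r, r]`. -/
theorem lintegral_gaussian_slab_le {a : ℝ} (ha : 0 < a) {X r : ℝ} (hX : 0 ≤ X) (hr : 0 < r)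
    (c : ℝ) :
    ∫⁻ s : ℝ, ENNReal.ofReal (if |s| ≤ r then exp (-a * (X / r * s + c) ^ 2) else 0) ≤
      ENNReal.ofReal ((4 + 2 * √(π / a)) / (1 + X) * r) := by
  have hK : 0 ≤ √(π / a) := Real.sqrt_nonneg _
  rcases le_or_gt X 1 with h | h
  · calc
      _ ≤ ∫⁻ s : ℝ, (Icc (-r) r).indicator 1 s := by
        refine lintegral_mono fun s => ?_
        by_cases hs : |s| ≤ r
        · have : s ∈ Icc (-r) r := abs_le.1 hs
          simp only [hs, if_true, this, indicator_of_mem, Pi.one_apply]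
          rw [ENNReal.ofReal_le_one, Real.exp_le_one_iff]
          nlinarith [sq_nonneg (X / r * s + c)]
        · simp [hs]
      _ = ENNReal.ofReal (2 * r) := by
        rw [lintegral_indicator_one measurableSet_Icc, Real.volume_Icc]
        ring_nf
      _ ≤ _ := by
        gcongr
        rw [le_div_iff₀ (by linarith)]
        linarith
  · have hXr : 0 < X / r := by positivity
    have hint : Integrable fun s : ℝ => exp (-a * (X / r * s + c) ^ 2) :=
      ((integrable_exp_neg_mul_sq ha).comp_add_right c).comp_mul_left' hXr.ne'
    calc
      _ ≤ ∫⁻ s : ℝ, ENNReal.ofReal (exp (-a * (X / r * s + c) ^ 2)) := by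
        gcongr with s
        split_ifs
        · exact le_rfl
        · positivity
      _ = ENNReal.ofReal (√(π / a) / X * r) := by
        rw [← ofReal_integral_eq_lintegral_ofReal hint (ae_of_all _ fun _ => (exp_pos _).le),
          Measure.integral_comp_mul_left (fun s => exp (-a * (s + c) ^ 2)) (X / r),
          integral_add_right_eq_self (fun s => exp (-a * s ^ 2)) c, integral_gaussian,
          abs_of_pos (by positivity), smul_eq_mul, inv_div]
        ring_nf
      _ ≤ _ := by
        gcongr ENNReal.ofReal (?_ * _)
        rw [div_le_div_iff₀ (by linarith) (by linarith)]
        nlinarith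

/-- The singular Gaussian integral left after the kernel's polynomial weights are bounded. -/
theorem lintegral_singular_gaussian_le {γ α₁ α₃ : ℝ} (α₂ : ℝ) (hγ : -3 < γ) (hα₁ : 0 < α₁)
    (hα₃ : 0 < α₃) (x : E3) :
    ∫⁻ u : E3, ENNReal.ofReal (‖u‖ ^ γ * exp (-α₁ * ‖u‖ ^ 2) *
        exp (-α₃ * (⟪u, x⟫ / ‖u‖ + α₂ * ‖u‖) ^ 2)) ≤
      ENNReal.ofReal (2 * π * ((4 + 2 * √(π / α₃)) / (1 + ‖x‖) *
        ∫ r in Ioi (0 : ℝ), r ^ (γ + 2) * exp (-α₁ * r ^ 2))) := by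
  obtain ⟨e, he, hxe⟩ : ∃ e : E3, ‖e‖ = 1 ∧ x = ‖x‖ • e := by
    rcases eq_or_ne x 0 with rfl | hx
    · exact ⟨EuclideanSpace.single 0 1, by simp, by simp⟩
    · have hn : ‖x‖ ≠ 0 := norm_ne_zero_iff.2 hx
      exact ⟨‖x‖⁻¹ • x, by rw [norm_smul, norm_inv, norm_norm, inv_mul_cancel₀ hn],
        by rw [smul_smul, mul_inv_cancel₀ hn, one_smul]⟩
  set X := ‖x‖
  have hX : 0 ≤ X := norm_nonneg x
  let F : ℝ → ℝ → ℝ≥0∞ := fun s r => ENNReal.ofReal (r ^ γ * exp (-α₁ * r ^ 2)) *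
    ENNReal.ofReal (if |s| ≤ r then exp (-α₃ * (X / r * s + α₂ * r) ^ 2) else 0)
  have hF : Measurable (Function.uncurry F) := by
    have h1 : Measurable fun p : ℝ × ℝ =>
        if |p.1| ≤ p.2 then exp (-α₃ * (X / p.2 * p.1 + α₂ * p.2) ^ 2) else 0 :=
      Measurable.ite (measurableSet_le (by fun_prop) (by fun_prop)) (by fun_prop) (by fun_prop)
    have h2 : Measurable fun p : ℝ × ℝ => p.2 ^ γ * exp (-α₁ * p.2 ^ 2) := by fun_prop
    exact h2.ennreal_ofReal.mul h1.ennreal_ofReal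
  have hint : IntegrableOn (fun r : ℝ => r ^ (γ + 2) * exp (-α₁ * r ^ 2)) (Ioi 0) :=
    integrableOn_rpow_mul_exp_neg_mul_sq hα₁ (by linarith)
  calc
    _ = ∫⁻ u : E3, F ⟪u, e⟫ ‖u‖ := by
      refine lintegral_congr fun u => ?_
      have hle : |⟪u, e⟫| ≤ ‖u‖ := by simpa [he] using abs_real_inner_le_norm u e
      have hinner : ⟪u, x⟫ / ‖u‖ = X / ‖u‖ * ⟪u, e⟫ := by
        rw [hxe, real_inner_smul_right]
        ring
      simp only [F, hle, if_true]
      rw [← ENNReal.ofReal_mul (by positivity), hinner]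
    _ ≤ ENNReal.ofReal (2 * π) * ∫⁻ r in Ioi (0 : ℝ), ENNReal.ofReal r * ∫⁻ s : ℝ, F s r :=
      lintegral_inner_norm_le F hF e he
    _ ≤ ENNReal.ofReal (2 * π) * ∫⁻ r in Ioi (0 : ℝ),
          ENNReal.ofReal ((4 + 2 * √(π / α₃)) / (1 + X) *
            (r ^ (γ + 2) * exp (-α₁ * r ^ 2))) := by
      refine mul_le_mul' le_rfl (setLIntegral_mono' measurableSet_Ioi fun r hr => ?_)
      have hr : 0 < r := hr
      rw [lintegral_const_mul' _ _ ENNReal.ofReal_ne_top]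
      calc
        _ ≤ ENNReal.ofReal r * (ENNReal.ofReal (r ^ γ * exp (-α₁ * r ^ 2)) *
              ENNReal.ofReal ((4 + 2 * √(π / α₃)) / (1 + X) * r)) := by
          gcongr
          exact lintegral_gaussian_slab_le hα₃ hX hr (α₂ * r)
        _ = _ := by
          rw [← ENNReal.ofReal_mul (by positivity), ← ENNReal.ofReal_mul hr.le,
            rpow_add hr, rpow_two]
          ring_nf
    _ = _ := by
      rw [← ofReal_integral_eq_lintegral_ofReal (hint.const_mul _), integral_const_mul,
        ← ENNReal.ofReal_mul (by positivity)]
      filter_upwards [ae_restrict_mem (measurableSet_Ioi (a := (0 : ℝ)))] with r hr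
      have : 0 < r := hr
      simp only [Pi.zero_apply]
      positivity

/-- The polynomial weights decay at least like `(1 + |v_*|)⁻²` when `γ ≤ -1`. -/
theorem weight_le {γ a b : ℝ} (hγ : γ ≤ -1) (ha : 0 ≤ a) (hb : 0 ≤ b) :
    (1 + a + b) ^ (γ - 1) * (1 + a) ^ (-γ) * (1 + a)⁻¹ ≤ (1 + b) ^ (-2 : ℝ) := by
  calc
    _ = (1 + a + b) ^ (γ - 1) * (1 + a) ^ (-γ - 1) := by
      rw [mul_assoc, ← rpow_neg_one (1 + a), ← rpow_add (by linarith), sub_eq_add_neg (-γ)]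
    _ ≤ (1 + a + b) ^ (γ - 1) * (1 + a + b) ^ (-γ - 1) := by
      have h : (1 + a) ^ (-γ - 1) ≤ (1 + a + b) ^ (-γ - 1) :=
        rpow_le_rpow (by linarith) (by linarith) (by linarith)
      gcongr
    _ = (1 + a + b) ^ (-2 : ℝ) := by
      rw [← rpow_add (by linarith)]
      ring_nf
    _ ≤ _ := rpow_le_rpow_of_nonpos (by linarith) (by linarith) (by norm_num)

theorem wGamma_of_lt {γ : ℝ} (hγ : γ < -1) {r : ℝ} (hr : 0 ≤ r) : wGamma γ r = r ^ γ := by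
  rw [wGamma, if_neg (by linarith), if_neg hγ.ne, abs_of_neg (by linarith), rpow_neg hr,
    one_div, inv_inv]

/-- For `−3 < γ ≤ −2` and a kernel `k*` satisfying the pointwise bound with the extra
angular Gaussian factor, `∫ |k*(·,v_*)| (1+|·|)⁻¹ ≤ C (1+|v_*|)^γ`. -/
theorem kstar_decay_bound_low_gamma (γ C₀ α₁ α₂ α₃ : ℝ) (hγl : -3 < γ) (hγu : γ ≤ -2)
    (hC₀ : 0 < C₀) (hα₁ : 0 < α₁) (hα₂ : 0 < α₂) (hα₃ : 0 < α₃) :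
    ∃ C > (0 : ℝ), ∀ kstar : E3 → E3 → ℝ, Measurable (Function.uncurry kstar) →
      (∀ v vs : E3, v ≠ vs →
        |kstar v vs| ≤ C₀ * wGamma γ ‖v - vs‖ * (1 + ‖v‖ + ‖vs‖) ^ (γ - 1) *
          (1 + ‖v‖) ^ (-γ) * Real.exp (-α₁ * ‖v - vs‖ ^ 2) *
          Real.exp (-α₃ * (⟪v - vs, vs⟫ / ‖v - vs‖ + α₂ * ‖v - vs‖) ^ 2)) →
      ∀ vs : E3,
        ∫⁻ v : E3, ENNReal.ofReal (|kstar v vs| * (1 + ‖v‖)⁻¹) ≤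
          ENNReal.ofReal (C * (1 + ‖vs‖) ^ γ) := by
  set I := ∫ r in Ioi (0 : ℝ), r ^ (γ + 2) * exp (-α₁ * r ^ 2)
  have hI : 0 ≤ I := setIntegral_nonneg measurableSet_Ioi fun r hr => by
    have : 0 < r := hr
    positivity
  set M := 4 + 2 * √(π / α₃)
  have hM : 0 < M := by positivity
  refine ⟨C₀ * (2 * π * (M * I)) + 1, by positivity, fun kstar _ hk vs => ?_⟩
  set X := ‖vs‖
  have hX : 0 ≤ X := norm_nonneg vs
  let g : E3 → ℝ := fun u => ‖u‖ ^ γ * exp (-α₁ * ‖u‖ ^ 2) *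
    exp (-α₃ * (⟪u, vs⟫ / ‖u‖ + α₂ * ‖u‖) ^ 2)
  calc
    _ ≤ ∫⁻ v : E3, ENNReal.ofReal (C₀ * (1 + X) ^ (-2 : ℝ)) * ENNReal.ofReal (g (v - vs)) := by
      refine lintegral_mono_ae ?_
      filter_upwards [compl_mem_ae_iff.2 (measure_singleton vs)] with v hv
      rw [← ENNReal.ofReal_mul (by positivity)]
      refine ENNReal.ofReal_le_ofReal ?_
      have hg : 0 ≤ g (v - vs) := by positivity
      calc
        _ ≤ _ := mul_le_mul_of_nonneg_right (hk v vs hv) (by positivity)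
        _ = C₀ * ((1 + ‖v‖ + X) ^ (γ - 1) * (1 + ‖v‖) ^ (-γ) * (1 + ‖v‖)⁻¹) * g (v - vs) := by
          rw [wGamma_of_lt (by linarith) (norm_nonneg _)]
          ring
        _ ≤ _ := by
          gcongr
          exact weight_le (by linarith) (norm_nonneg v) hX
    _ = ENNReal.ofReal (C₀ * (1 + X) ^ (-2 : ℝ)) * ∫⁻ u : E3, ENNReal.ofReal (g u) := by
      rw [lintegral_const_mul' _ _ ENNReal.ofReal_ne_top,
        lintegral_sub_right_eq_self (fun u => ENNReal.ofReal (g u)) vs]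
    _ ≤ ENNReal.ofReal (C₀ * (1 + X) ^ (-2 : ℝ)) *
          ENNReal.ofReal (2 * π * (M / (1 + X) * I)) := by
      gcongr
      exact lintegral_singular_gaussian_le α₂ hγl hα₁ hα₃ vs
    _ ≤ _ := by
      rw [← ENNReal.ofReal_mul (by positivity)]
      refine ENNReal.ofReal_le_ofReal ?_
      calc
        _ = C₀ * (2 * π * (M * I)) * (1 + X) ^ (-3 : ℝ) := by
          rw [show (-3 : ℝ) = -2 + -1 by norm_num, rpow_add (by linarith), rpow_neg_one]
          ring
        _ ≤ _ := by
          gcongr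
          · exact le_add_of_nonneg_right zero_le_one
          · linarith
end
end

section
/- Let −3 < γ ≤ −2 and let k* : ℝ³ × ℝ³ → ℝ be a kernel such that, for each fixed v_* ∈ ℝ³, the function v ↦ k*(v, v_*) is differentiable on ℝ³ \ {v_*}, and such that there exist constants C₀ > 0 and α₁, α₂, α₃ > 0 with |k*(v, v_*)| ≤ C₀ w_γ(|v − v_*|) (1 + |v| + |v_*|)^{γ−1} (1 + |v|)^{−γ} e^{−α₁ |v − v_*|²} and |∇_v k*(v, v_*)| ≤ C₀ w_γ(|v − v_*|) (1 + |v|)^{1−γ} |v − v_*|^{−1} (1 + |v| + |v_*|)^{γ−1} e^{−α₁ |v − v_*|²} e^{−α₃ ((v − v_*)·v/|v − v_*| − α₂ |v − v_*|)²} for all v ≠ v_*. Then there exists a constant C > 0 such that for all u, v ∈ ℝ³ with 0 < |u − v| ≤ 1: ∫_{ℝ³} |k*(u, v_*) − k*(v, v_*)| dv_* ≤ C max{(1 + |u|)^{−1}, (1 + |v|)^{−1}} · Φ(|u − v|), where Φ(r) = r^{3+γ} if −3 < γ < −2 and Φ(r) = r(|log r| + 1) if γ = −2. -/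
open MeasureTheory Real Set
open scoped ENNReal RealInnerProductSpace

noncomputable section

/-- The change of variables `x = cos θ`. -/
lemma lintegral_sin_mul_comp_cos_le (g : ℝ → ℝ≥0∞) :
    ∫⁻ θ in Ioo 0 π, ENNReal.ofReal (sin θ) * g (cos θ) ≤ ∫⁻ x in Ioo (-1) 1, g x := by
  have himg : cos '' Ioo 0 π ⊆ Ioo (-1) 1 := by
    rintro _ ⟨θ, ⟨h0, hπ⟩, rfl⟩
    constructor
    · rw [← cos_pi]
      exact cos_lt_cos_of_nonneg_of_le_pi h0.le le_rfl hπ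
    · rw [← cos_zero]
      exact cos_lt_cos_of_nonneg_of_le_pi le_rfl hπ.le h0
  refine le_trans (le_of_eq ?_) (lintegral_mono_set himg)
  rw [lintegral_image_eq_lintegral_abs_deriv_mul measurableSet_Ioo
    (fun θ _ => (hasDerivAt_cos θ).hasDerivWithinAt) (injOn_cos.mono Ioo_subset_Icc_self)]
  refine setLIntegral_congr_fun measurableSet_Ioo fun θ hθ => ?_
  simp only [abs_neg, abs_of_pos (sin_pos_of_mem_Ioo hθ)]

lemma lintegral_halfPlane_le {F : ℝ → ℝ → ℝ≥0∞} (hF : Measurable (Function.uncurry F)) :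
    ∫⁻ z, ∫⁻ ρ in Ioi 0, ENNReal.ofReal ρ * F (√(z ^ 2 + ρ ^ 2)) z ≤
      ∫⁻ r in Ioi 0, ENNReal.ofReal (r ^ 2) * ∫⁻ x in Ioo (-1) 1, F r (r * x) := by
  let G : ℝ × ℝ → ℝ≥0∞ := fun p =>
    (Ioi (0 : ℝ)).indicator (fun ρ => ENNReal.ofReal ρ * F (√(p.1 ^ 2 + ρ ^ 2)) p.1) p.2
  have hG : Measurable G := by
    have : G = {p : ℝ × ℝ | 0 < p.2}.indicator
        (fun p => ENNReal.ofReal p.2 * F (√(p.1 ^ 2 + p.2 ^ 2)) p.1) := by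
      ext p; simp [G, indicator]
    rw [this]
    refine Measurable.indicator ?_ (measurableSet_lt measurable_const measurable_snd)
    refine (by fun_prop : Measurable fun p : ℝ × ℝ => ENNReal.ofReal p.2).mul ?_
    exact hF.comp (by fun_prop : Measurable fun p : ℝ × ℝ => (√(p.1 ^ 2 + p.2 ^ 2), p.1))
  calc _ = ∫⁻ z, ∫⁻ ρ, G (z, ρ) := by
        refine lintegral_congr fun z => ?_
        rw [← lintegral_indicator measurableSet_Ioi]
    _ = ∫⁻ p : ℝ × ℝ, G p := (lintegral_prod _ hG.aemeasurable).symm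
    _ = ∫⁻ p in Ioi (0 : ℝ) ×ˢ Ioo (-π) π,
          ENNReal.ofReal p.1 * G (p.1 * cos p.2, p.1 * sin p.2) :=
        (lintegral_comp_polarCoord_symm G).symm
    _ = ∫⁻ r in Ioi (0 : ℝ), ∫⁻ θ in Ioo (-π) π,
          ENNReal.ofReal r * G (r * cos θ, r * sin θ) := by
        rw [Measure.volume_eq_prod, ← Measure.prod_restrict, lintegral_prod]
        refine ((by fun_prop : Measurable fun p : ℝ × ℝ => ENNReal.ofReal p.1).mul
          (hG.comp (by fun_prop))).aemeasurable
    _ ≤ _ := by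
        refine setLIntegral_mono' measurableSet_Ioi fun r hr => ?_
        have hr : 0 < r := hr
        calc _ ≤ ∫⁻ θ in Ioo (-π) π, (Ioo 0 π).indicator (fun θ =>
                ENNReal.ofReal (r ^ 2) * (ENNReal.ofReal (sin θ) * F r (r * cos θ))) θ := by
              refine setLIntegral_mono' measurableSet_Ioo fun θ hθ => ?_
              by_cases h : 0 < θ
              · have hs := sin_pos_of_mem_Ioo ⟨h, hθ.2⟩
                have hn : √((r * cos θ) ^ 2 + (r * sin θ) ^ 2) = r := by
                  rw [mul_pow, mul_pow, ← mul_add, cos_sq_add_sin_sq, mul_one, sqrt_sq hr.le]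
                have hmem : θ ∈ Ioo 0 π := ⟨h, hθ.2⟩
                have hmem' : r * sin θ ∈ Ioi (0 : ℝ) := mul_pos hr hs
                simp only [G, indicator_of_mem hmem, indicator_of_mem hmem', hn]
                rw [ENNReal.ofReal_mul hr.le, sq, ENNReal.ofReal_mul hr.le]
                simp only [mul_assoc, le_refl]
              · have hs := sin_nonpos_of_nonpos_of_neg_pi_le (not_lt.1 h) hθ.1.le
                have hn : r * sin θ ∉ Ioi (0 : ℝ) :=
                  not_lt.2 (mul_nonpos_of_nonneg_of_nonpos hr.le hs)
                simp [G, indicator_of_notMem hn]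
          _ ≤ ∫⁻ θ, (Ioo 0 π).indicator (fun θ =>
                ENNReal.ofReal (r ^ 2) * (ENNReal.ofReal (sin θ) * F r (r * cos θ))) θ :=
              setLIntegral_le_lintegral _ _
          _ = ENNReal.ofReal (r ^ 2) *
                ∫⁻ θ in Ioo 0 π, ENNReal.ofReal (sin θ) * F r (r * cos θ) := by
              rw [lintegral_indicator measurableSet_Ioo, lintegral_const_mul' _ _ ENNReal.ofReal_ne_top]
          _ ≤ _ := by
              refine mul_le_mul' le_rfl ?_
              exact lintegral_sin_mul_comp_cos_le fun x => F r (r * x)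

lemma lintegral_comp_norm_coord_le {F : ℝ → ℝ → ℝ≥0∞} (hF : Measurable (Function.uncurry F)) :
    ∫⁻ y : E3, F ‖y‖ (y 0) ≤ ENNReal.ofReal (2 * π) *
      ∫⁻ r in Ioi 0, ENNReal.ofReal (r ^ 2) * ∫⁻ x in Ioo (-1) 1, F r (r * x) := by
  let H : ℝ × (ℝ × ℝ) → ℝ≥0∞ := fun p => F (√(p.1 ^ 2 + (p.2.1 ^ 2 + p.2.2 ^ 2))) p.1
  have hH : Measurable H := hF.comp
    (by fun_prop : Measurable fun p : ℝ × (ℝ × ℝ) => (√(p.1 ^ 2 + (p.2.1 ^ 2 + p.2.2 ^ 2)), p.1))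
  have hmp : MeasurePreserving (fun y : E3 => (y 0, (y 1, y 2))) :=
    ((MeasurePreserving.id volume).prod (volume_preserving_finTwoArrow ℝ)).comp
      ((volume_preserving_piFinSuccAbove (fun _ : Fin 3 => ℝ) 0).comp
        (PiLp.volume_preserving_ofLp (Fin 3)))
  calc _ = ∫⁻ y : E3, H (y 0, (y 1, y 2)) := by
        refine lintegral_congr fun y => ?_
        simp only [H]
        rw [EuclideanSpace.norm_eq, Fin.sum_univ_three]
        simp [add_assoc]
    _ = ∫⁻ p, H p := hmp.lintegral_comp hH
    _ = ∫⁻ z, ∫⁻ q : ℝ × ℝ, H (z, q) := lintegral_prod _ hH.aemeasurable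
    _ = ∫⁻ z, ENNReal.ofReal (2 * π) *
          ∫⁻ ρ in Ioi 0, ENNReal.ofReal ρ * F (√(z ^ 2 + ρ ^ 2)) z := by
        refine lintegral_congr fun z => ?_
        rw [← lintegral_comp_polarCoord_symm fun q => H (z, q)]
        calc _ = ∫⁻ p in Ioi (0 : ℝ) ×ˢ Ioo (-π) π,
                ENNReal.ofReal p.1 * F (√(z ^ 2 + p.1 ^ 2)) z := by
              refine lintegral_congr fun p => ?_
              have : (p.1 * cos p.2) ^ 2 + (p.1 * sin p.2) ^ 2 = p.1 ^ 2 := by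
                rw [mul_pow, mul_pow, ← mul_add, cos_sq_add_sin_sq, mul_one]
              simp only [H, polarCoord_symm_apply, smul_eq_mul, this]
          _ = _ := by
              rw [Measure.volume_eq_prod, ← Measure.prod_restrict, lintegral_prod]
              · simp only [lintegral_const, Measure.restrict_apply_univ, Real.volume_Ioo]
                rw [lintegral_mul_const' _ _ ENNReal.ofReal_ne_top, mul_comm]
                congr 2
                ring
              · refine ((by fun_prop : Measurable fun p : ℝ × ℝ => ENNReal.ofReal p.1).mul
                  (hF.comp (by fun_prop :
                    Measurable fun p : ℝ × ℝ => (√(z ^ 2 + p.1 ^ 2), z)))).aemeasurable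
    _ = ENNReal.ofReal (2 * π) * ∫⁻ z, ∫⁻ ρ in Ioi 0,
          ENNReal.ofReal ρ * F (√(z ^ 2 + ρ ^ 2)) z :=
        lintegral_const_mul' _ _ ENNReal.ofReal_ne_top
    _ ≤ _ := mul_le_mul' le_rfl (lintegral_halfPlane_le hF)

/-- Spherical coordinates with polar axis `w`. -/
lemma lintegral_comp_norm_inner_le (w : E3) {F : ℝ → ℝ → ℝ≥0∞}
    (hF : Measurable (Function.uncurry F)) :
    ∫⁻ y : E3, F ‖y‖ ⟪y, w⟫ ≤ ENNReal.ofReal (2 * π) *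
      ∫⁻ r in Ioi 0, ENNReal.ofReal (r ^ 2) * ∫⁻ x in Ioo (-1) 1, F r (r * x * ‖w‖) := by
  let e : E3 := EuclideanSpace.single 0 ‖w‖
  have he : ‖e‖ = ‖w‖ := by simp [e]
  let T : E3 ≃ₗᵢ[ℝ] E3 := (Submodule.span ℝ {e - w})ᗮ.reflection
  have hT : T e = w := Submodule.reflection_sub he
  calc _ = ∫⁻ y : E3, F ‖T y‖ ⟪T y, w⟫ :=
        (T.measurePreserving.lintegral_comp
          (hF.comp (by fun_prop : Measurable fun y : E3 => (‖y‖, ⟪y, w⟫)))).symm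
    _ = ∫⁻ y : E3, F ‖y‖ (y 0 * ‖w‖) := by
        refine lintegral_congr fun y => ?_
        rw [← hT, T.inner_map_map, T.norm_map, T.norm_map, he]
        simp [e, EuclideanSpace.inner_single_right, mul_comm]
    _ ≤ _ := lintegral_comp_norm_coord_le (F := fun r s => F r (s * ‖w‖))
        (hF.comp (by fun_prop : Measurable fun p : ℝ × ℝ => (p.1, p.2 * ‖w‖)))

/-- The modulus of continuity `Φ`. -/
def holderModulus (γ r : ℝ) : ℝ :=
  if γ = -2 then r * (|Real.log r| + 1) else r ^ (3 + γ)

lemma holderModulus_nonneg (γ : ℝ) {r : ℝ} (hr : 0 ≤ r) : 0 ≤ holderModulus γ r := by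
  unfold holderModulus
  split_ifs <;> positivity

lemma rpow_le_holderModulus (γ : ℝ) {r : ℝ} (hr : 0 ≤ r) : r ^ (3 + γ) ≤ holderModulus γ r := by
  unfold holderModulus
  split_ifs with h
  · have : (3 : ℝ) + -2 = 1 := by norm_num
    rw [h, this, rpow_one]
    nlinarith [abs_nonneg (Real.log r)]
  · rfl

lemma lintegral_gaussian_strip_le {α : ℝ} (hα : 0 < α) {W : ℝ} (hW : 0 ≤ W) (s : ℝ) :
    ∫⁻ x in Ioo (-1 : ℝ) 1, ENNReal.ofReal (exp (-α * (x * W - s) ^ 2)) ≤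
      ENNReal.ofReal ((4 + 2 * √(π / α)) * (1 + W)⁻¹) := by
  rcases le_or_gt W 1 with h | h
  · calc _ ≤ ∫⁻ x in Ioo (-1 : ℝ) 1, 1 := by
          refine lintegral_mono fun x => ?_
          rw [ENNReal.ofReal_le_one, exp_le_one_iff]
          nlinarith [sq_nonneg (x * W - s)]
      _ = ENNReal.ofReal 2 := by
          rw [setLIntegral_one, Real.volume_Ioo]; norm_num
      _ ≤ _ := by
          refine ENNReal.ofReal_le_ofReal ?_
          rw [← div_eq_mul_inv, le_div_iff₀ (by linarith)]
          nlinarith [sqrt_nonneg (π / α)]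
  · have hW0 : 0 < W := by linarith
    have hintegrable : Integrable fun x : ℝ => exp (-α * (x * W - s) ^ 2) :=
      ((integrable_exp_neg_mul_sq hα).comp_sub_right s).comp_mul_right' hW0.ne'
    have hval : ∫ x : ℝ, exp (-α * (x * W - s) ^ 2) = W⁻¹ * √(π / α) := by
      rw [Measure.integral_comp_mul_right (fun x => exp (-α * (x - s) ^ 2)) W,
        integral_sub_right_eq_self (fun x => exp (-α * x ^ 2)) s, integral_gaussian,
        abs_of_pos (inv_pos.2 hW0), smul_eq_mul]
    refine (setLIntegral_le_lintegral _ _).trans ?_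
    rw [← ofReal_integral_eq_lintegral_ofReal hintegrable (ae_of_all _ fun x => (exp_pos _).le), hval]
    refine ENNReal.ofReal_le_ofReal ?_
    have h1 : W⁻¹ ≤ 2 * (1 + W)⁻¹ := by
      rw [inv_eq_one_div, ← div_eq_mul_inv, div_le_div_iff₀ hW0 (by linarith)]
      linarith
    have h2 : 0 < (1 + W)⁻¹ := by positivity
    nlinarith [sqrt_nonneg (π / α)]

lemma exists_radial_bound {γ α : ℝ} (hγ : γ ≤ -2) (hα : 0 < α) :
    ∃ C > (0 : ℝ), ∀ h : ℝ, 0 < h → h ≤ 1 →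
      ENNReal.ofReal h * ∫⁻ r in Ioi h, ENNReal.ofReal (r ^ (γ + 1) * exp (-α * r ^ 2)) ≤
        ENNReal.ofReal (C * holderModulus γ h) := by
  have hexp : ∀ r : ℝ, exp (-α * r ^ 2) ≤ 1 := fun r =>
    exp_le_one_iff.2 (by nlinarith [sq_nonneg r])
  rcases hγ.lt_or_eq with hlt | rfl
  · have hpos : 0 < -(γ + 2) := by linarith
    refine ⟨(-(γ + 2))⁻¹, inv_pos.2 hpos, fun h h0 _ => ?_⟩
    have hle : ∫⁻ r in Ioi h, ENNReal.ofReal (r ^ (γ + 1) * exp (-α * r ^ 2)) ≤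
        ENNReal.ofReal ((-(γ + 2))⁻¹ * h ^ (γ + 2)) := by
      calc _ ≤ ∫⁻ r in Ioi h, ENNReal.ofReal (r ^ (γ + 1)) := by
            refine setLIntegral_mono' measurableSet_Ioi fun r hr => ENNReal.ofReal_le_ofReal ?_
            exact mul_le_of_le_one_right (rpow_nonneg (h0.trans hr).le _) (hexp r)
        _ = ENNReal.ofReal (∫ r in Ioi h, r ^ (γ + 1)) := by
            rw [ofReal_integral_eq_lintegral_ofReal
              (integrableOn_Ioi_rpow_of_lt (by linarith) h0)]
            filter_upwards [ae_restrict_mem measurableSet_Ioi] with r hr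
            exact rpow_nonneg (h0.trans hr).le _
        _ = _ := by
            rw [integral_Ioi_rpow_of_lt (by linarith) h0]
            congr 1
            rw [show γ + 1 + 1 = γ + 2 by ring, inv_neg, neg_div, div_eq_inv_mul, neg_mul]
    refine (mul_le_mul' le_rfl hle).trans ?_
    rw [← ENNReal.ofReal_mul h0.le, holderModulus, if_neg hlt.ne]
    refine ENNReal.ofReal_le_ofReal (le_of_eq ?_)
    rw [show 3 + γ = 1 + (γ + 2) by ring, rpow_add h0 1, rpow_one]
    ring
  · refine ⟨1 + √(π / α), by positivity, fun h h0 h1 => ?_⟩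
    have hle : ∫⁻ r in Ioi h, ENNReal.ofReal (r ^ (-2 + 1 : ℝ) * exp (-α * r ^ 2)) ≤
        ENNReal.ofReal (|Real.log h| + √(π / α)) := by
      rw [← Ioc_union_Ioi_eq_Ioi h1, lintegral_union measurableSet_Ioi
        (Ioc_disjoint_Ioi le_rfl), ENNReal.ofReal_add (abs_nonneg _) (sqrt_nonneg _)]
      have hrp : ∀ r : ℝ, r ^ (-2 + 1 : ℝ) = r⁻¹ := fun r => by
        rw [show (-2 + 1 : ℝ) = -1 by norm_num, rpow_neg_one]
      refine add_le_add ?_ ?_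
      · calc _ ≤ ∫⁻ r in Ioc h 1, ENNReal.ofReal r⁻¹ := by
              refine setLIntegral_mono' measurableSet_Ioc fun r hr => ENNReal.ofReal_le_ofReal ?_
              rw [hrp]
              exact mul_le_of_le_one_right (inv_nonneg.2 (h0.trans hr.1).le) (hexp r)
          _ = ENNReal.ofReal (∫ r in h..1, r⁻¹) := by
              rw [intervalIntegral.integral_of_le h1, ofReal_integral_eq_lintegral_ofReal]
              · refine (intervalIntegrable_iff_integrableOn_Ioc_of_le h1).1 ?_
                refine intervalIntegral.intervalIntegrable_inv (fun r hr => ?_) continuousOn_id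
                rw [uIcc_of_le h1] at hr
                exact (h0.trans_le hr.1).ne'
              · filter_upwards [ae_restrict_mem measurableSet_Ioc] with r hr
                exact inv_nonneg.2 (h0.trans hr.1).le
          _ ≤ _ := by
              rw [integral_inv_of_pos h0 one_pos, one_div, Real.log_inv]
              exact ENNReal.ofReal_le_ofReal (neg_le_abs _)
      · calc _ ≤ ∫⁻ r in Ioi (1 : ℝ), ENNReal.ofReal (exp (-α * r ^ 2)) := by
              refine setLIntegral_mono' measurableSet_Ioi fun r hr => ENNReal.ofReal_le_ofReal ?_
              rw [hrp]
              exact mul_le_of_le_one_left (exp_pos _).le (inv_le_one_of_one_le₀ (le_of_lt hr))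
          _ ≤ ∫⁻ r, ENNReal.ofReal (exp (-α * r ^ 2)) := setLIntegral_le_lintegral _ _
          _ = _ := by
              rw [← ofReal_integral_eq_lintegral_ofReal (integrable_exp_neg_mul_sq hα)
                (ae_of_all _ fun r => (exp_pos _).le), integral_gaussian]
    refine (mul_le_mul' le_rfl hle).trans ?_
    rw [← ENNReal.ofReal_mul h0.le, holderModulus, if_pos rfl]
    refine ENNReal.ofReal_le_ofReal ?_
    have : 0 ≤ |Real.log h| * √(π / α) := by positivity
    nlinarith

lemma lintegral_ball_rpow_le {γ : ℝ} (hγ : -3 < γ) {R : ℝ} (hR : 0 < R) :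
    ∫⁻ y : E3, (Iio R).indicator (fun r => ENNReal.ofReal (r ^ γ)) ‖y‖ ≤
      ENNReal.ofReal (4 * π / (3 + γ) * R ^ (3 + γ)) := by
  have hmeas : Measurable ((Iio R).indicator fun r : ℝ => ENNReal.ofReal (r ^ γ)) :=
    Measurable.indicator (by fun_prop) measurableSet_Iio
  have h3 : 0 < 3 + γ := by linarith
  refine (lintegral_comp_norm_inner_le 0
    (F := fun r _ => (Iio R).indicator (fun r => ENNReal.ofReal (r ^ γ)) r)
    (hmeas.comp measurable_fst)).trans ?_
  have hle : ∫⁻ r in Ioi 0, ENNReal.ofReal (r ^ 2) *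
      ∫⁻ _ in Ioo (-1 : ℝ) 1, (Iio R).indicator (fun r => ENNReal.ofReal (r ^ γ)) r ≤
      ENNReal.ofReal 2 * ENNReal.ofReal (R ^ (3 + γ) / (3 + γ)) := by
    calc _ = ∫⁻ r in Ioi 0, (Iio R).indicator
            (fun r => ENNReal.ofReal 2 * ENNReal.ofReal (r ^ (2 + γ))) r := by
          refine setLIntegral_congr_fun measurableSet_Ioi fun r hr => ?_
          have hr : 0 < r := hr
          simp only [lintegral_const, Measure.restrict_apply_univ, Real.volume_Ioo]
          by_cases h : r < R
          · rw [indicator_of_mem (show r ∈ Iio R from h), indicator_of_mem (show r ∈ Iio R from h),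
              mul_comm _ (ENNReal.ofReal (1 - -1)), mul_left_comm,
              ← ENNReal.ofReal_mul (sq_nonneg r), rpow_add hr]
            norm_num
          · simp [h]
      _ = ∫⁻ r in Ioo 0 R, ENNReal.ofReal 2 * ENNReal.ofReal (r ^ (2 + γ)) := by
          rw [setLIntegral_indicator measurableSet_Iio, Iio_inter_Ioi]
      _ ≤ ∫⁻ r in Ioc 0 R, ENNReal.ofReal 2 * ENNReal.ofReal (r ^ (2 + γ)) :=
          lintegral_mono_set Ioo_subset_Ioc_self
      _ = ENNReal.ofReal 2 * ENNReal.ofReal (∫ r in 0..R, r ^ (2 + γ)) := by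
          rw [lintegral_const_mul' _ _ ENNReal.ofReal_ne_top,
            intervalIntegral.integral_of_le hR.le, ofReal_integral_eq_lintegral_ofReal]
          · exact (intervalIntegrable_iff_integrableOn_Ioc_of_le hR.le).1
              (intervalIntegral.intervalIntegrable_rpow' (by linarith))
          · filter_upwards [ae_restrict_mem measurableSet_Ioc] with r hr
            exact rpow_nonneg hr.1.le _
      _ = _ := by
          rw [integral_rpow (Or.inl (by linarith)), show 2 + γ + 1 = 3 + γ by ring,
            zero_rpow h3.ne', sub_zero]
  refine (mul_le_mul' le_rfl hle).trans ?_
  rw [← ENNReal.ofReal_mul zero_le_two, ← ENNReal.ofReal_mul (by positivity)]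
  refine ENNReal.ofReal_le_ofReal (le_of_eq ?_)
  ring

/-- The radial and angular profile of the gradient bound, truncated to radii at least `h`. -/
def gradProfile (γ α₁ α₂ α₃ h r s : ℝ) : ℝ≥0∞ :=
  (Ici h).indicator (fun r => ENNReal.ofReal
    (r ^ (γ - 1) * exp (-α₁ * r ^ 2) * exp (-α₃ * (s / r - α₂ * r) ^ 2))) r

lemma measurable_gradProfile (γ α₁ α₂ α₃ h : ℝ) :
    Measurable (Function.uncurry (gradProfile γ α₁ α₂ α₃ h)) := by
  have : Function.uncurry (gradProfile γ α₁ α₂ α₃ h) = {p : ℝ × ℝ | h ≤ p.1}.indicator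
      fun p => ENNReal.ofReal
        (p.1 ^ (γ - 1) * exp (-α₁ * p.1 ^ 2) * exp (-α₃ * (p.2 / p.1 - α₂ * p.1) ^ 2)) := by
    ext p; simp [Function.uncurry, gradProfile, indicator]
  rw [this]
  exact Measurable.indicator (by fun_prop) (measurableSet_le measurable_const measurable_fst)

lemma exists_gradProfile_bound {γ α₁ α₃ : ℝ} (α₂ : ℝ) (hγ : γ ≤ -2) (hα₁ : 0 < α₁)
    (hα₃ : 0 < α₃) :
    ∃ C > (0 : ℝ), ∀ (h : ℝ) (w : E3), 0 < h → h ≤ 1 →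
      ENNReal.ofReal h * ∫⁻ y : E3, gradProfile γ α₁ α₂ α₃ h ‖y‖ ⟪y, w⟫ ≤
        ENNReal.ofReal (C * (1 + ‖w‖)⁻¹ * holderModulus γ h) := by
  obtain ⟨C, hC, hbound⟩ := exists_radial_bound hγ hα₁
  set D := 4 + 2 * √(π / α₃) with hD
  have hD0 : 0 < D := by positivity
  refine ⟨2 * π * D * C, by positivity, fun h w h0 h1 => ?_⟩
  have hw : 0 ≤ (1 + ‖w‖)⁻¹ := by positivity
  have hle : ∫⁻ r in Ioi 0, ENNReal.ofReal (r ^ 2) *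
      ∫⁻ x in Ioo (-1) 1, gradProfile γ α₁ α₂ α₃ h r (r * x * ‖w‖) ≤
      ENNReal.ofReal (D * (1 + ‖w‖)⁻¹) *
        ∫⁻ r in Ioi h, ENNReal.ofReal (r ^ (γ + 1) * exp (-α₁ * r ^ 2)) := by
    calc _ ≤ ∫⁻ r in Ioi 0, (Ici h).indicator (fun r => ENNReal.ofReal (D * (1 + ‖w‖)⁻¹) *
            ENNReal.ofReal (r ^ (γ + 1) * exp (-α₁ * r ^ 2))) r := by
          refine setLIntegral_mono' measurableSet_Ioi fun r hr => ?_
          have hr : 0 < r := hr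
          by_cases hrh : h ≤ r
          · have hmem : r ∈ Ici h := hrh
            have hrew : ∀ x : ℝ, gradProfile γ α₁ α₂ α₃ h r (r * x * ‖w‖) =
                ENNReal.ofReal (r ^ (γ - 1) * exp (-α₁ * r ^ 2)) *
                  ENNReal.ofReal (exp (-α₃ * (x * ‖w‖ - α₂ * r) ^ 2)) := fun x => by
              rw [gradProfile, indicator_of_mem hmem, ← ENNReal.ofReal_mul (by positivity),
                mul_assoc r, mul_div_cancel_left₀ _ hr.ne']
            simp only [hrew]
            rw [indicator_of_mem hmem, lintegral_const_mul' _ _ ENNReal.ofReal_ne_top, ← mul_assoc,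
              ← ENNReal.ofReal_mul (sq_nonneg r), mul_comm (ENNReal.ofReal (D * _))]
            refine mul_le_mul' (le_of_eq ?_)
              (lintegral_gaussian_strip_le hα₃ (norm_nonneg w) (α₂ * r))
            rw [show γ + 1 = 2 + (γ - 1) by ring, rpow_add hr, rpow_two, mul_assoc]
          · simp [gradProfile, hrh]
      _ ≤ ∫⁻ r, (Ici h).indicator (fun r => ENNReal.ofReal (D * (1 + ‖w‖)⁻¹) *
            ENNReal.ofReal (r ^ (γ + 1) * exp (-α₁ * r ^ 2))) r :=
          setLIntegral_le_lintegral _ _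
      _ = _ := by
          rw [lintegral_indicator measurableSet_Ici, lintegral_const_mul' _ _ ENNReal.ofReal_ne_top,
            setLIntegral_congr Ioi_ae_eq_Ici.symm]
  calc _ ≤ ENNReal.ofReal h * (ENNReal.ofReal (2 * π) * (ENNReal.ofReal (D * (1 + ‖w‖)⁻¹) *
          ∫⁻ r in Ioi h, ENNReal.ofReal (r ^ (γ + 1) * exp (-α₁ * r ^ 2)))) :=
        mul_le_mul' le_rfl ((lintegral_comp_norm_inner_le w
          (measurable_gradProfile γ α₁ α₂ α₃ h)).trans (mul_le_mul' le_rfl hle))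
    _ = ENNReal.ofReal (2 * π) * ENNReal.ofReal (D * (1 + ‖w‖)⁻¹) * (ENNReal.ofReal h *
          ∫⁻ r in Ioi h, ENNReal.ofReal (r ^ (γ + 1) * exp (-α₁ * r ^ 2))) := by ring
    _ ≤ ENNReal.ofReal (2 * π) * ENNReal.ofReal (D * (1 + ‖w‖)⁻¹) *
          ENNReal.ofReal (C * holderModulus γ h) := mul_le_mul' le_rfl (hbound h h0 h1)
    _ = _ := by
        rw [← ENNReal.ofReal_mul (by positivity), ← ENNReal.ofReal_mul (by positivity)]
        congr 1
        ring

lemma wGamma_eq_rpow {γ r : ℝ} (hγ : γ ≤ -2) (hr : 0 ≤ r) : wGamma γ r = r ^ γ := by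
  rw [wGamma, if_neg (by linarith), if_neg (by linarith), abs_of_neg (by linarith),
    rpow_neg hr, one_div, inv_inv]

lemma rpow_mul_rpow_le {γ a b s : ℝ} (hγ : γ ≤ 1) (ha : 0 ≤ a) (hb : 0 ≤ b) :
    (1 + a + b) ^ (γ - 1) * (1 + a) ^ s ≤ (1 + a) ^ (γ - 1 + s) := by
  have ha1 : 0 < 1 + a := by linarith
  rw [rpow_add ha1]
  exact mul_le_mul_of_nonneg_right
    (rpow_le_rpow_of_nonpos ha1 (by linarith) (by linarith)) (rpow_nonneg ha1.le _)

/-- The mean value inequality in integral form, along a segment on which the gradient of `f`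
is controlled by a continuous function. -/
lemma ofReal_abs_sub_le_lintegral_segment {f : E3 → ℝ} {g : E3 → ℝ} {u v : E3}
    (hf : ∀ t ∈ Icc (0 : ℝ) 1, DifferentiableAt ℝ f (v + t • (u - v)))
    (hg : ContinuousOn (fun t : ℝ => g (v + t • (u - v))) (Icc 0 1))
    (hfg : ∀ t ∈ Icc (0 : ℝ) 1, ‖fderiv ℝ f (v + t • (u - v))‖ ≤ g (v + t • (u - v))) :
    ENNReal.ofReal |f u - f v| ≤ ENNReal.ofReal ‖u - v‖ *
      ∫⁻ t in Ioc (0 : ℝ) 1, ENNReal.ofReal (g (v + t • (u - v))) := by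
  have hline : ∀ t : ℝ, HasDerivAt (fun t : ℝ => v + t • (u - v)) (u - v) t := fun t => by
    simpa using ((hasDerivAt_id t).smul_const (u - v)).const_add v
  have hder : ∀ t ∈ Icc (0 : ℝ) 1, HasDerivAt (fun t : ℝ => f (v + t • (u - v)))
      (fderiv ℝ f (v + t • (u - v)) (u - v)) t := fun t ht =>
    (hf t ht).hasFDerivAt.comp_hasDerivAt t (hline t)
  have hintegrable : IntervalIntegrable (fun t : ℝ => g (v + t • (u - v))) volume 0 1 :=
    ContinuousOn.intervalIntegrable (by rwa [uIcc_of_le zero_le_one])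
  have key := norm_sub_le_integral_of_norm_deriv_le_of_le
    (f := fun t : ℝ => f (v + t • (u - v))) (B := fun t => ‖u - v‖ * g (v + t • (u - v)))
    zero_le_one
    (fun t ht => (hder t ht).continuousAt.continuousWithinAt)
    (fun t ht => (hder t (Ioo_subset_Icc_self ht)).differentiableAt.differentiableWithinAt)
    (ae_of_all _ fun t ht => by
      have ht := Ioo_subset_Icc_self ht
      rw [(hder t ht).deriv, mul_comm]
      exact ((fderiv ℝ f _).le_opNorm _).trans
        (mul_le_mul_of_nonneg_right (hfg t ht) (norm_nonneg _)))
    (hintegrable.const_mul _)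
  rw [one_smul, zero_smul, add_zero, add_sub_cancel, Real.norm_eq_abs,
    intervalIntegral.integral_const_mul] at key
  refine (ENNReal.ofReal_le_ofReal key).trans (le_of_eq ?_)
  rw [ENNReal.ofReal_mul (norm_nonneg _), intervalIntegral.integral_of_le zero_le_one,
    ofReal_integral_eq_lintegral_ofReal
      ((intervalIntegrable_iff_integrableOn_Ioc_of_le zero_le_one).1 hintegrable)]
  filter_upwards [ae_restrict_mem measurableSet_Ioc] with t ht
  exact (norm_nonneg _).trans (hfg t (Ioc_subset_Icc_self ht))

lemma ofReal_abs_sub_le_of_norm_fderiv_le {γ C₀ α₁ α₂ α₃ : ℝ} (hC₀ : 0 < C₀)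
    {f : E3 → ℝ} {u v vs : E3} (huv : u ≠ v) (hfar : 2 * ‖u - v‖ ≤ ‖v - vs‖)
    (hf : ∀ x, x ≠ vs → DifferentiableAt ℝ f x)
    (hf' : ∀ x, x ≠ vs → ‖fderiv ℝ f x‖ ≤ C₀ * (‖x - vs‖ ^ (γ - 1) *
      exp (-α₁ * ‖x - vs‖ ^ 2) * exp (-α₃ * (⟪x - vs, x⟫ / ‖x - vs‖ - α₂ * ‖x - vs‖) ^ 2))) :
    ENNReal.ofReal |f u - f v| ≤ ENNReal.ofReal C₀ * (ENNReal.ofReal ‖u - v‖ *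
      ∫⁻ t in Ioc (0 : ℝ) 1, gradProfile γ α₁ α₂ α₃ ‖u - v‖ ‖v + t • (u - v) - vs‖
        ⟪v + t • (u - v) - vs, v + t • (u - v)⟫) := by
  have h0 : 0 < ‖u - v‖ := norm_pos_iff.2 (sub_ne_zero.2 huv)
  have hdist : ∀ t ∈ Icc (0 : ℝ) 1, ‖u - v‖ ≤ ‖v + t • (u - v) - vs‖ := fun t ht => by
    have h1 : ‖t • (u - v)‖ ≤ ‖u - v‖ := by
      rw [norm_smul, Real.norm_of_nonneg ht.1]
      exact mul_le_of_le_one_left (norm_nonneg _) ht.2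
    have h2 : ‖v - vs‖ ≤ ‖v + t • (u - v) - vs‖ + ‖t • (u - v)‖ := by
      refine le_trans (le_of_eq ?_) (norm_sub_le _ _)
      congr 1
      abel
    linarith
  have hne : ∀ t ∈ Icc (0 : ℝ) 1, v + t • (u - v) ≠ vs := fun t ht h => by
    have := hdist t ht
    rw [h, sub_self, norm_zero] at this
    linarith
  have hn : ∀ t ∈ Icc (0 : ℝ) 1, ‖v + t • (u - v) - vs‖ ≠ 0 := fun t ht =>
    (h0.trans_le (hdist t ht)).ne'
  have hcont : ContinuousOn (fun t : ℝ => ‖v + t • (u - v) - vs‖) (Icc 0 1) := by fun_prop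
  refine (ofReal_abs_sub_le_lintegral_segment (g := fun x => C₀ * (‖x - vs‖ ^ (γ - 1) *
      exp (-α₁ * ‖x - vs‖ ^ 2) * exp (-α₃ * (⟪x - vs, x⟫ / ‖x - vs‖ - α₂ * ‖x - vs‖) ^ 2)))
    (fun t ht => hf _ (hne t ht)) ?_
    (fun t ht => hf' _ (hne t ht))).trans (le_of_eq ?_)
  · refine continuousOn_const.mul (((hcont.rpow_const fun t ht => Or.inl (hn t ht)).mul
      (by fun_prop)).mul ?_)
    refine Real.continuous_exp.comp_continuousOn (continuousOn_const.mul (ContinuousOn.pow ?_ 2))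
    exact (ContinuousOn.div (by fun_prop) hcont hn).sub (by fun_prop)
  · rw [mul_left_comm (ENNReal.ofReal C₀),
      ← lintegral_const_mul' (ENNReal.ofReal C₀) _ ENNReal.ofReal_ne_top]
    congr 1
    refine setLIntegral_congr_fun measurableSet_Ioc fun t ht => ?_
    have hmem : ‖v + t • (u - v) - vs‖ ∈ Ici ‖u - v‖ := hdist t (Ioc_subset_Icc_self ht)
    simp only [gradProfile, indicator_of_mem hmem]
    rw [ENNReal.ofReal_mul hC₀.le]

lemma ofReal_abs_sub_le_of_near {γ A : ℝ} (hA : 0 ≤ A) {a b : ℝ} {u v vs : E3}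
    (hnear : ‖v - vs‖ < 2 * ‖u - v‖)
    (ha : |a| ≤ A * ‖u - vs‖ ^ γ) (hb : |b| ≤ A * ‖v - vs‖ ^ γ) :
    ENNReal.ofReal |a - b| ≤ ENNReal.ofReal A *
      ((Iio (3 * ‖u - v‖)).indicator (fun r => ENNReal.ofReal (r ^ γ)) ‖u - vs‖ +
        (Iio (2 * ‖u - v‖)).indicator (fun r => ENNReal.ofReal (r ^ γ)) ‖v - vs‖) := by
  have hmem : ‖u - vs‖ ∈ Iio (3 * ‖u - v‖) := by
    have : ‖u - vs‖ ≤ ‖u - v‖ + ‖v - vs‖ := norm_sub_le_norm_sub_add_norm_sub u v vs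
    exact lt_of_le_of_lt this (by linarith)
  rw [indicator_of_mem hmem, indicator_of_mem (show ‖v - vs‖ ∈ Iio (2 * ‖u - v‖) from hnear),
    ← ENNReal.ofReal_add (by positivity) (by positivity), ← ENNReal.ofReal_mul hA]
  refine ENNReal.ofReal_le_ofReal ((abs_sub a b).trans ?_)
  rw [mul_add]
  exact add_le_add ha hb

/-- Averaging the profile along a segment keeps its integral bound, because the weights
`(1 + ‖w‖)⁻¹` are comparable along a segment of length at most one. -/
lemma lintegral_segment_gradProfile_le {γ α₁ α₂ α₃ C : ℝ} (hC : 0 < C)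
    (hbound : ∀ (h : ℝ) (w : E3), 0 < h → h ≤ 1 →
      ENNReal.ofReal h * ∫⁻ y : E3, gradProfile γ α₁ α₂ α₃ h ‖y‖ ⟪y, w⟫ ≤
        ENNReal.ofReal (C * (1 + ‖w‖)⁻¹ * holderModulus γ h))
    {u v : E3} (huv : u ≠ v) (h1 : ‖u - v‖ ≤ 1) :
    ∫⁻ vs : E3, ENNReal.ofReal ‖u - v‖ *
      ∫⁻ t in Ioc (0 : ℝ) 1, gradProfile γ α₁ α₂ α₃ ‖u - v‖ ‖v + t • (u - v) - vs‖
        ⟪v + t • (u - v) - vs, v + t • (u - v)⟫ ≤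
      ENNReal.ofReal (2 * C * (1 + ‖v‖)⁻¹ * holderModulus γ ‖u - v‖) := by
  have h0 : 0 < ‖u - v‖ := norm_pos_iff.2 (sub_ne_zero.2 huv)
  have hm : Measurable fun p : E3 × ℝ => gradProfile γ α₁ α₂ α₃ ‖u - v‖
      ‖v + p.2 • (u - v) - p.1‖ ⟪v + p.2 • (u - v) - p.1, v + p.2 • (u - v)⟫ :=
    (measurable_gradProfile γ α₁ α₂ α₃ ‖u - v‖).comp
      (by fun_prop : Measurable fun p : E3 × ℝ =>
        (‖v + p.2 • (u - v) - p.1‖, ⟪v + p.2 • (u - v) - p.1, v + p.2 • (u - v)⟫))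
  rw [lintegral_const_mul' _ _ ENNReal.ofReal_ne_top, lintegral_lintegral_swap hm.aemeasurable,
    ← lintegral_const_mul' _ _ ENNReal.ofReal_ne_top]
  calc _ ≤ ∫⁻ t in Ioc (0 : ℝ) 1,
          ENNReal.ofReal (2 * C * (1 + ‖v‖)⁻¹ * holderModulus γ ‖u - v‖) := by
        refine setLIntegral_mono' measurableSet_Ioc fun t ht => ?_
        set w := v + t • (u - v) with hw
        rw [lintegral_sub_left_eq_self (fun y : E3 => gradProfile γ α₁ α₂ α₃ ‖u - v‖ ‖y‖ ⟪y, w⟫) w]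
        refine (hbound _ w h0 h1).trans (ENNReal.ofReal_le_ofReal ?_)
        have hvw : ‖v‖ ≤ ‖w‖ + 1 := by
          have hd : ‖t • (u - v)‖ ≤ 1 := by
            rw [norm_smul, Real.norm_of_nonneg ht.1.le]
            exact mul_le_one₀ ht.2 (norm_nonneg _) h1
          have : v = w - t • (u - v) := by rw [hw]; abel
          calc ‖v‖ = ‖w - t • (u - v)‖ := congrArg _ this
            _ ≤ ‖w‖ + 1 := (norm_sub_le _ _).trans (by linarith)
        have hinv : (1 + ‖w‖)⁻¹ ≤ 2 * (1 + ‖v‖)⁻¹ := by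
          rw [inv_eq_one_div, ← div_eq_mul_inv, div_le_div_iff₀ (by positivity) (by positivity)]
          linarith [norm_nonneg w]
        refine mul_le_mul_of_nonneg_right ?_ (holderModulus_nonneg γ h0.le)
        calc C * (1 + ‖w‖)⁻¹ ≤ C * (2 * (1 + ‖v‖)⁻¹) := mul_le_mul_of_nonneg_left hinv hC.le
          _ = _ := by ring
    _ = _ := by simp

/-- Hölder-type continuity in `v` of the integral `∫ |k*(u, v_*) − k*(v, v_*)| dv_*`
for `−3 < γ ≤ −2`, with modulus `Φ(r) = r^{3+γ}` for `γ < −2` and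
`Φ(r) = r(|log r| + 1)` for `γ = −2`. -/
theorem kstar_holder_estimate (γ C₀ α₁ α₂ α₃ : ℝ) (hγl : -3 < γ) (hγu : γ ≤ -2)
    (hC₀ : 0 < C₀) (hα₁ : 0 < α₁) (hα₂ : 0 < α₂) (hα₃ : 0 < α₃)
    (kstar : E3 → E3 → ℝ)
    (hdiff : ∀ (vs v : E3), v ≠ vs → DifferentiableAt ℝ (fun u => kstar u vs) v)
    (hb : ∀ v vs : E3, v ≠ vs →
      |kstar v vs| ≤ C₀ * wGamma γ ‖v - vs‖ * (1 + ‖v‖ + ‖vs‖) ^ (γ - 1) *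
        (1 + ‖v‖) ^ (-γ) * Real.exp (-α₁ * ‖v - vs‖ ^ 2))
    (hb' : ∀ v vs : E3, v ≠ vs →
      ‖fderiv ℝ (fun u => kstar u vs) v‖ ≤
        C₀ * wGamma γ ‖v - vs‖ * (1 + ‖v‖) ^ (1 - γ) * ‖v - vs‖⁻¹ *
          (1 + ‖v‖ + ‖vs‖) ^ (γ - 1) * Real.exp (-α₁ * ‖v - vs‖ ^ 2) *
          Real.exp (-α₃ * (⟪v - vs, v⟫ / ‖v - vs‖ - α₂ * ‖v - vs‖) ^ 2)) :
    ∃ C > (0 : ℝ), ∀ u v : E3, u ≠ v → ‖u - v‖ ≤ 1 →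
      ∫⁻ vs : E3, ENNReal.ofReal |kstar u vs - kstar v vs| ≤
        ENNReal.ofReal (C * max (1 + ‖u‖)⁻¹ (1 + ‖v‖)⁻¹ *
          (if γ = -2 then ‖u - v‖ * (|Real.log ‖u - v‖| + 1) else ‖u - v‖ ^ (3 + γ))) := by
  have hk : ∀ v vs : E3, v ≠ vs → |kstar v vs| ≤ C₀ * (1 + ‖v‖)⁻¹ * ‖v - vs‖ ^ γ := by
    intro v vs hne
    refine (hb v vs hne).trans ?_
    have hw := rpow_mul_rpow_le (s := -γ) (by linarith : γ ≤ 1) (norm_nonneg v) (norm_nonneg vs)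
    rw [show γ - 1 + -γ = -1 by ring, rpow_neg_one] at hw
    have hexp : exp (-α₁ * ‖v - vs‖ ^ 2) ≤ 1 :=
      exp_le_one_iff.2 (by nlinarith [sq_nonneg ‖v - vs‖])
    refine (mul_le_of_le_one_right ?_ hexp).trans ?_ <;> rw [wGamma_eq_rpow hγu (norm_nonneg _)]
    · positivity
    · calc _ = C₀ * ‖v - vs‖ ^ γ * ((1 + ‖v‖ + ‖vs‖) ^ (γ - 1) * (1 + ‖v‖) ^ (-γ)) := by ring
        _ ≤ C₀ * ‖v - vs‖ ^ γ * (1 + ‖v‖)⁻¹ := mul_le_mul_of_nonneg_left hw (by positivity)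
        _ = _ := by ring
  have hk' : ∀ v vs : E3, v ≠ vs → ‖fderiv ℝ (fun u => kstar u vs) v‖ ≤
      C₀ * (‖v - vs‖ ^ (γ - 1) * exp (-α₁ * ‖v - vs‖ ^ 2) *
        exp (-α₃ * (⟪v - vs, v⟫ / ‖v - vs‖ - α₂ * ‖v - vs‖) ^ 2)) := by
    intro v vs hne
    refine (hb' v vs hne).trans ?_
    have hpos : 0 < ‖v - vs‖ := norm_pos_iff.2 (sub_ne_zero.2 hne)
    have hw := rpow_mul_rpow_le (s := 1 - γ) (by linarith : γ ≤ 1) (norm_nonneg v) (norm_nonneg vs)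
    rw [show γ - 1 + (1 - γ) = 0 by ring, rpow_zero] at hw
    rw [wGamma_eq_rpow hγu hpos.le, rpow_sub_one hpos.ne']
    set E := exp (-α₁ * ‖v - vs‖ ^ 2) *
      exp (-α₃ * (⟪v - vs, v⟫ / ‖v - vs‖ - α₂ * ‖v - vs‖) ^ 2) with hE
    have hE0 : 0 < E := by positivity
    calc _ = C₀ * (‖v - vs‖ ^ γ / ‖v - vs‖ * E) *
          ((1 + ‖v‖ + ‖vs‖) ^ (γ - 1) * (1 + ‖v‖) ^ (1 - γ)) := by rw [hE]; ring
      _ ≤ C₀ * (‖v - vs‖ ^ γ / ‖v - vs‖ * E) * 1 :=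
          mul_le_mul_of_nonneg_left hw (by positivity)
      _ = _ := by rw [hE]; ring
  obtain ⟨C, hC, hbound⟩ := exists_gradProfile_bound (γ := γ) α₂ hγu hα₁ hα₃
  have h3 : 0 < 3 + γ := by linarith
  set B := 4 * π / (3 + γ) with hB
  have hB0 : 0 < B := by positivity
  refine ⟨C₀ * (B * 3 ^ (3 + γ) + B * 2 ^ (3 + γ)) + C₀ * (2 * C), by positivity,
    fun u v huv h1 => ?_⟩
  have h0 : 0 < ‖u - v‖ := norm_pos_iff.2 (sub_ne_zero.2 huv)
  set M := max (1 + ‖u‖)⁻¹ (1 + ‖v‖)⁻¹ with hM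
  have hM0 : 0 < M := lt_max_of_lt_left (by positivity)
  let N : ℝ → ℝ → ℝ≥0∞ := fun R => (Iio R).indicator fun r => ENNReal.ofReal (r ^ γ)
  have hN : ∀ (R : ℝ) (x : E3), Measurable fun vs : E3 => N R ‖x - vs‖ := fun R x =>
    (Measurable.indicator (by fun_prop) measurableSet_Iio : Measurable (N R)).comp (by fun_prop)
  have hNint : ∀ c : ℝ, 0 < c → ∀ x : E3, ∫⁻ vs : E3, N (c * ‖u - v‖) ‖x - vs‖ ≤
      ENNReal.ofReal (B * c ^ (3 + γ) * holderModulus γ ‖u - v‖) := fun c hc x => by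
    rw [lintegral_sub_left_eq_self (fun y : E3 => N (c * ‖u - v‖) ‖y‖) x]
    refine (lintegral_ball_rpow_le hγl (mul_pos hc h0)).trans (ENNReal.ofReal_le_ofReal ?_)
    rw [mul_rpow hc.le h0.le, ← mul_assoc]
    exact mul_le_mul_of_nonneg_left (rpow_le_holderModulus γ h0.le) (by positivity)
  let S : E3 → ℝ≥0∞ := fun vs => ENNReal.ofReal ‖u - v‖ *
    ∫⁻ t in Ioc (0 : ℝ) 1, gradProfile γ α₁ α₂ α₃ ‖u - v‖ ‖v + t • (u - v) - vs‖
      ⟪v + t • (u - v) - vs, v + t • (u - v)⟫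
  have hpt : ∀ᵐ vs : E3, ENNReal.ofReal |kstar u vs - kstar v vs| ≤
      ENNReal.ofReal (C₀ * M) * (N (3 * ‖u - v‖) ‖u - vs‖ + N (2 * ‖u - v‖) ‖v - vs‖) +
        ENNReal.ofReal C₀ * S vs := by
    filter_upwards [compl_mem_ae_iff.2 (measure_singleton u),
      compl_mem_ae_iff.2 (measure_singleton v)] with vs hu hv
    have hu : u ≠ vs := fun h => hu h.symm
    have hv : v ≠ vs := fun h => hv h.symm
    rcases lt_or_ge ‖v - vs‖ (2 * ‖u - v‖) with hnear | hfar
    · refine le_add_right (ofReal_abs_sub_le_of_near (by positivity) hnear ?_ ?_)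
      · refine (hk u vs hu).trans ?_
        gcongr
        exact le_max_left _ _
      · refine (hk v vs hv).trans ?_
        gcongr
        exact le_max_right _ _
    · exact le_add_left (ofReal_abs_sub_le_of_norm_fderiv_le hC₀ huv hfar
        (fun x hx => hdiff vs x hx) fun x hx => hk' x vs hx)
  change _ ≤ ENNReal.ofReal (_ * holderModulus γ ‖u - v‖)
  have hΦ := holderModulus_nonneg γ h0.le
  calc _ ≤ ∫⁻ vs : E3, (ENNReal.ofReal (C₀ * M) *
          (N (3 * ‖u - v‖) ‖u - vs‖ + N (2 * ‖u - v‖) ‖v - vs‖) + ENNReal.ofReal C₀ * S vs) :=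
        lintegral_mono_ae hpt
    _ = ENNReal.ofReal (C₀ * M) * ((∫⁻ vs : E3, N (3 * ‖u - v‖) ‖u - vs‖) +
          ∫⁻ vs : E3, N (2 * ‖u - v‖) ‖v - vs‖) + ENNReal.ofReal C₀ * ∫⁻ vs, S vs := by
        rw [lintegral_add_left (((hN (3 * ‖u - v‖) u).fun_add (hN (2 * ‖u - v‖) v)).const_mul _),
          lintegral_const_mul' _ _ ENNReal.ofReal_ne_top, lintegral_add_left (hN _ u),
          lintegral_const_mul' _ _ ENNReal.ofReal_ne_top]
    _ ≤ ENNReal.ofReal (C₀ * M) *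
          (ENNReal.ofReal (B * 3 ^ (3 + γ) * holderModulus γ ‖u - v‖) +
            ENNReal.ofReal (B * 2 ^ (3 + γ) * holderModulus γ ‖u - v‖)) +
          ENNReal.ofReal C₀ *
            ENNReal.ofReal (2 * C * (1 + ‖v‖)⁻¹ * holderModulus γ ‖u - v‖) :=
        add_le_add
          (mul_le_mul' le_rfl (add_le_add (hNint 3 (by norm_num) u) (hNint 2 (by norm_num) v)))
          (mul_le_mul' le_rfl (lintegral_segment_gradProfile_le hC hbound huv h1))
    _ ≤ _ := by
        rw [← ENNReal.ofReal_add (by positivity) (by positivity),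
          ← ENNReal.ofReal_mul (by positivity), ← ENNReal.ofReal_mul hC₀.le,
          ← ENNReal.ofReal_add (by positivity) (by positivity)]
        refine ENNReal.ofReal_le_ofReal ?_
        have hv : (1 + ‖v‖)⁻¹ ≤ M := le_max_right _ _
        have : C₀ * (2 * C * (1 + ‖v‖)⁻¹ * holderModulus γ ‖u - v‖) ≤
            C₀ * (2 * C * M * holderModulus γ ‖u - v‖) := by gcongr
        linarith
end
end
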